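/- arXiv:1801.07163 — 2 statements merged into one kernel-verified Lean document; each statement's English description precedes it below -/
import Mathlib

section
/- (Theorem 4.2, main result) For every positive integer n, the sequence I_{n,0}^B, I_{n,1}^B, …, I_{n,n}^B is unimodal; more precisely, I_{n,k−1}^B ≤ I_{n,k}^B for all 1 ≤ k ≤ ⌊n/2⌋, and I_{n,k}^B ≥ I_{n,k+1}^B for all ⌈n/2⌉ ≤ k ≤ n−1. -/
open scoped Classical

/-- `Ω_n = {±1, …, ±n}` as a subset of `ℤ`. -/
def OmegaSet (n : ℕ) : Set ℤ := {a : ℤ | 1 ≤ |a| ∧ |a| ≤ (n : ℤ)}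

/-- A signed permutation of length `n`: a bijection of `Ω_n` satisfying `w(-a) = -w(a)`,
extended by the identity outside `Ω_n`. -/
def IsSignedPerm (n : ℕ) (w : ℤ → ℤ) : Prop :=
  (∀ a : ℤ, w (-a) = -w a) ∧ Set.BijOn w (OmegaSet n) (OmegaSet n) ∧
    ∀ a : ℤ, a ∉ OmegaSet n → w a = a

/-- An involution in the hyperoctahedral group `B_n`. -/
def IsSignedInvolution (n : ℕ) (w : ℤ → ℤ) : Prop :=
  IsSignedPerm n w ∧ ∀ a : ℤ, w (w a) = a

/-- The total order `-1 <_r -2 <_r ⋯ <_r 0 <_r 1 <_r 2 <_r ⋯` on `ℤ`. -/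
def rlt (a b : ℤ) : Prop :=
  (a < 0 ∧ b < 0 ∧ b < a) ∨ (a < 0 ∧ 0 ≤ b) ∨ (0 ≤ a ∧ 0 ≤ b ∧ a < b)

/-- `des_B(w) = #{ i ∈ {0,…,n-1} : w(i) >_r w(i+1) }` (with `w(0) = 0`, which is forced by
antisymmetry). -/
noncomputable def desB (n : ℕ) (w : ℤ → ℤ) : ℕ :=
  ((Finset.range n).filter fun i : ℕ => rlt (w ((i : ℤ) + 1)) (w (i : ℤ))).card

/-- `I_{n,k}^B`, the number of involutions `w` in `B_n` with `des_B(w) = k`. -/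
noncomputable def InkB (n k : ℕ) : ℕ :=
  {w : ℤ → ℤ | IsSignedInvolution n w ∧ desB n w = k}.ncard

theorem unimodal_of_recurrence (A : ℕ → ℤ → ℤ) (hneg : ∀ (n : ℕ) (k : ℤ), k < 0 → A n k = 0)
    (hnonneg : ∀ n k, 0 ≤ A n k) (hsymm0 : ∀ k, A 0 k = A 0 (-k))
    (hsymm1 : ∀ k, A 1 k = A 1 (1 - k))
    (hrec : ∀ (n : ℕ) (k : ℤ), ((n : ℤ) + 2) * A (n + 2) k =
      (2 * k + 1) * A (n + 1) k + (2 * (n + 2 - k) + 1) * A (n + 1) (k - 1)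
      + (2 * k ^ 2 + 2 * k + n + 1) * A n k
      + (4 * (k - 1) * (n + 1 - k) + 2 * n + 2) * A n (k - 1)
      + (2 * (n + 3 - k) * (n + 2 - k) + n + 1) * A n (k - 2)) (n : ℕ) :
    (∀ k : ℤ, A n k = A n (n - k)) ∧ ∀ k : ℤ, 2 * k ≤ n → A n (k - 1) ≤ A n k := by
  have hstart : ∀ (n : ℕ) (k : ℤ), k ≤ 0 → A n (k - 1) ≤ A n k := fun n k hk => by
    rw [hneg n (k - 1) (by omega)]; exact hnonneg n k
  induction n using Nat.twoStepInduction with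
  | zero => exact ⟨by simpa using hsymm0, fun k hk => hstart 0 k (by omega)⟩
  | one => exact ⟨by simpa using hsymm1, fun k hk => hstart 1 k (by omega)⟩
  | more n ihb iha =>
    obtain ⟨bs, bm⟩ := ihb
    obtain ⟨as, am⟩ := iha
    have hn : (0 : ℤ) < (n : ℤ) + 2 := by positivity
    push_cast at as am ⊢
    constructor
    · intro k
      apply mul_left_cancel₀ hn.ne'
      rw [hrec, hrec, as k, as (k - 1), bs k, bs (k - 1), bs (k - 2)]
      ring_nf
    · intro k hk
      rcases le_or_gt k 0 with h0 | h0
      · exact hstart _ k h0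
      apply le_of_mul_le_mul_left _ hn
      rw [← sub_nonneg]
      have key : ((n : ℤ) + 2) * A (n + 2) k - (n + 2) * A (n + 2) (k - 1) =
          (2 * k + 1) * (A (n + 1) k - A (n + 1) (k - 1))
          + (2 * (n + 2 - k) + 3) * (A (n + 1) (k - 1) - A (n + 1) (k - 1 - 1))
          + (2 * k ^ 2 + 2 * k + n + 1) * (A n k - A n (k - 1))
          + (4 * k + 4 * (k - 1) * (n + 1 - k) + 2 * n + 2) * (A n (k - 1) - A n (k - 1 - 1))
          + (2 * (n + 4 - k) * (n + 3 - k) + n + 1) * (A n (k - 2) - A n (k - 2 - 1)) := by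
        rw [hrec, hrec]
        ring_nf
      rw [key]
      have e1 : 0 ≤ A (n + 1) k - A (n + 1) (k - 1) := by
        rcases (by omega : 2 * k ≤ n + 1 ∨ 2 * k = n + 2) with h | h
        · exact sub_nonneg.2 (am k h)
        · rw [as k, show (n : ℤ) + 1 - k = k - 1 by omega, sub_self]
      have e2 := sub_nonneg.2 (am (k - 1) (by omega))
      have e3 := sub_nonneg.2 (bm (k - 1) (by omega))
      have e4 := sub_nonneg.2 (bm (k - 2) (by omega))
      have f1 : 0 ≤ (2 * k + 1) * (A (n + 1) k - A (n + 1) (k - 1)) :=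
        mul_nonneg (by omega) e1
      have f2 : 0 ≤ (2 * (n + 2 - k) + 3) * (A (n + 1) (k - 1) - A (n + 1) (k - 1 - 1)) :=
        mul_nonneg (by omega) e2
      have f4 : 0 ≤ (2 * ((n : ℤ) + 4 - k) * (n + 3 - k) + n + 1) *
          (A n (k - 2) - A n (k - 2 - 1)) :=
        mul_nonneg (by nlinarith) e4
      have hc : 0 ≤ 4 * (k - 1) * ((n : ℤ) + 1 - k) :=
        mul_nonneg (by omega) (by omega)
      have f3 : 0 ≤ (2 * k ^ 2 + 2 * k + n + 1) * (A n k - A n (k - 1))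
          + (4 * k + 4 * (k - 1) * (n + 1 - k) + 2 * n + 2) *
            (A n (k - 1) - A n (k - 1 - 1)) := by
        rcases (by omega : 2 * k ≤ n ∨ 2 * k = n + 1 ∨ 2 * k = n + 2) with h | h | h
        · exact add_nonneg (mul_nonneg (by positivity) (sub_nonneg.2 (bm k h)))
            (mul_nonneg (by linarith) e3)
        · rw [bs k, show (n : ℤ) - k = k - 1 by omega, sub_self, mul_zero, zero_add]
          exact mul_nonneg (by linarith) e3
        · rw [bs k, show (n : ℤ) - k = k - 1 - 1 by omega]
          have : (n : ℤ) = 2 * k - 2 := by omega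
          rw [this]
          have := mul_nonneg (by nlinarith [sq_nonneg (k - 1)] : 0 ≤ 2 * (k - 1) ^ 2 + 1) e3
          linarith
      linarith

theorem choose_step_one (n r k : ℕ) (hk : k ≤ n + 1) :
    (2 * (r : ℤ) + 1) * ((n + 1 + r - k).choose (n + 1) : ℤ) =
      (2 * k + 1) * ((n + 2 + r - k).choose (n + 2) : ℤ)
      + (2 * (n + 1 - k) + 1) * ((n + 2 + r - (k + 1)).choose (n + 2) : ℤ) := by
  rcases lt_or_ge r k with h | h
  · rw [Nat.choose_eq_zero_of_lt (by omega), Nat.choose_eq_zero_of_lt (by omega),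
      Nat.choose_eq_zero_of_lt (by omega)]
    simp
  obtain ⟨d, rfl⟩ := Nat.exists_eq_add_of_le h
  rw [show n + 1 + (k + d) - k = n + 1 + d by omega,
    show n + 2 + (k + d) - k = n + 1 + d + 1 by omega,
    show n + 2 + (k + d) - (k + 1) = n + 1 + d by omega, Nat.choose_succ_succ]
  have hx := Nat.choose_succ_right_eq (n + 1 + d) (n + 1)
  rw [show n + 1 + d - (n + 1) = d by omega] at hx
  have hx' : ((n + 1 + d).choose (n + 2) : ℤ) * (n + 2) = (n + 1 + d).choose (n + 1) * d := by
    exact_mod_cast hx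
  push_cast
  linear_combination (-2) * hx'

theorem choose_step_two (n r k : ℕ) (hk : k ≤ n) :
    (2 * (r : ℤ) ^ 2 + 2 * r + n + 1) * ((n + r - k).choose n : ℤ) =
      (2 * k ^ 2 + 2 * k + n + 1) * ((n + 2 + r - k).choose (n + 2) : ℤ)
      + (4 * k * (n - k) + 2 * n + 2) * ((n + 2 + r - (k + 1)).choose (n + 2) : ℤ)
      + (2 * (n + 1 - k) * (n - k) + n + 1) * ((n + 2 + r - (k + 2)).choose (n + 2) : ℤ) := by
  rcases lt_or_ge r k with h | h
  · rw [Nat.choose_eq_zero_of_lt (by omega), Nat.choose_eq_zero_of_lt (by omega),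
      Nat.choose_eq_zero_of_lt (by omega), Nat.choose_eq_zero_of_lt (by omega)]
    simp
  obtain ⟨d, rfl⟩ := Nat.exists_eq_add_of_le h
  rw [show n + (k + d) - k = n + d by omega, show n + 2 + (k + d) - k = n + d + 1 + 1 by omega,
    show n + 2 + (k + d) - (k + 1) = n + d + 1 by omega,
    show n + 2 + (k + d) - (k + 2) = n + d by omega]
  simp only [Nat.choose_succ_succ, Nat.succ_eq_add_one]
  have hx := Nat.choose_succ_right_eq (n + d) n
  have hy := Nat.choose_succ_right_eq (n + d) (n + 1)
  rw [show n + d - n = d by omega] at hx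
  have hx' : ((n + d).choose (n + 1) : ℤ) * (n + 1) = (n + d).choose n * d := by
    exact_mod_cast hx
  have hy' : ((n + d).choose (n + 2) : ℤ) * (n + 2) = (n + d).choose (n + 1) * (d - 1) := by
    rcases d with _ | d
    · simp [Nat.choose_eq_zero_of_lt]
    · rw [show n + (d + 1) - (n + 1) = d by omega] at hy
      push_cast
      rw [add_sub_cancel_right]
      exact_mod_cast hy
  push_cast
  linear_combination (-2 * ((n : ℤ) + 1)) * hy' - (4 * (k : ℤ) + 2 * d + 2) * hx'

theorem eq_zero_of_sum_choose (n : ℕ) (c : ℕ → ℤ)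
    (h : ∀ r : ℕ, ∑ k ∈ Finset.range (n + 1), c k * ((n + r - k).choose n : ℤ) = 0)
    (k : ℕ) (hk : k ≤ n) : c k = 0 := by
  induction k using Nat.strong_induction_on with
  | _ k ih =>
    have := h k
    rw [Finset.sum_eq_single k] at this
    · simpa using this
    · intro j hj hne
      rcases lt_or_gt_of_ne hne with h' | h'
      · rw [ih j h' (by omega), zero_mul]
      · rw [Finset.mem_range] at hj
        rw [Nat.choose_eq_zero_of_lt (by omega)]; simp
    · intro h'; exact absurd (Finset.mem_range.2 (by omega)) h'

theorem recurrence_of_choose_expansion (A : ℕ → ℤ → ℤ) (p : ℕ → ℕ → ℤ)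
    (hneg : ∀ (n : ℕ) (k : ℤ), k < 0 → A n k = 0)
    (hlarge : ∀ (n : ℕ) (k : ℤ), n < k → A n k = 0)
    (hA : ∀ n r : ℕ, p n r = ∑ k ∈ Finset.range (n + 1), A n k * ((n + r - k).choose n : ℤ))
    (hp : ∀ n r : ℕ, ((n : ℤ) + 2) * p (n + 2) r =
      (2 * r + 1) * p (n + 1) r + (2 * r ^ 2 + 2 * r + n + 1) * p n r) (n : ℕ) (k : ℤ) :
    ((n : ℤ) + 2) * A (n + 2) k =
      (2 * k + 1) * A (n + 1) k + (2 * (n + 2 - k) + 1) * A (n + 1) (k - 1)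
      + (2 * k ^ 2 + 2 * k + n + 1) * A n k
      + (4 * (k - 1) * (n + 1 - k) + 2 * n + 2) * A n (k - 1)
      + (2 * (n + 3 - k) * (n + 2 - k) + n + 1) * A n (k - 2) := by
  rcases lt_or_ge k 0 with h | h
  · simp [hneg _ k h, hneg _ (k - 1) (by omega), hneg _ (k - 2) (by omega)]
  rcases lt_or_ge ((n : ℤ) + 2) k with h' | h'
  · rw [hlarge _ k (by push_cast; omega), hlarge _ k (by push_cast; omega),
      hlarge _ (k - 1) (by push_cast; omega), hlarge _ k (by omega), hlarge _ (k - 1) (by omega),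
      hlarge _ (k - 2) (by omega)]
    simp
  lift k to ℕ using h
  let B (j : ℕ) : ℤ := (2 * j + 1) * A (n + 1) j
  let C (j : ℕ) : ℤ := (2 * (n + 2 - j) + 1) * A (n + 1) (j - 1)
  let D (j : ℕ) : ℤ := (2 * j ^ 2 + 2 * j + n + 1) * A n j
  let E (j : ℕ) : ℤ := (4 * (j - 1) * (n + 1 - j) + 2 * n + 2) * A n (j - 1)
  let F (j : ℕ) : ℤ := (2 * (n + 3 - j) * (n + 2 - j) + n + 1) * A n (j - 2)
  suffices hz : ((n : ℤ) + 2) * A (n + 2) k - (B k + C k + D k + E k + F k) = 0 by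
    simp only [B, C, D, E, F] at hz
    linarith
  refine eq_zero_of_sum_choose (n + 2)
    (fun j => ((n : ℤ) + 2) * A (n + 2) j - (B j + C j + D j + E j + F j)) (fun r => ?_) k
    (by omega)
  let ch (j : ℕ) : ℤ := ((n + 2 + r - j).choose (n + 2) : ℤ)
  have hB : ∑ j ∈ Finset.range (n + 3), B j * ch j = ∑ j ∈ Finset.range (n + 2), B j * ch j := by
    rw [Finset.sum_range_succ, add_eq_left]
    simp only [B]
    rw [hlarge _ _ (by push_cast; omega)]; simp
  have hC : ∑ j ∈ Finset.range (n + 3), C j * ch j =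
      ∑ j ∈ Finset.range (n + 2), C (j + 1) * ch (j + 1) := by
    rw [Finset.sum_range_succ', add_eq_left]
    simp only [C]
    rw [hneg _ _ (by simp)]; simp
  have hD : ∑ j ∈ Finset.range (n + 3), D j * ch j = ∑ j ∈ Finset.range (n + 1), D j * ch j := by
    rw [Finset.sum_range_succ, Finset.sum_range_succ]
    simp only [D]
    rw [hlarge _ _ (by push_cast; omega), hlarge _ _ (by push_cast; omega)]; simp
  have hE : ∑ j ∈ Finset.range (n + 3), E j * ch j =
      ∑ j ∈ Finset.range (n + 1), E (j + 1) * ch (j + 1) := by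
    rw [Finset.sum_range_succ', Finset.sum_range_succ]
    simp only [E]
    rw [hneg n (((0 : ℕ) : ℤ) - 1) (by simp), hlarge n (_ - _) (by push_cast; omega)]; simp
  have hF : ∑ j ∈ Finset.range (n + 3), F j * ch j =
      ∑ j ∈ Finset.range (n + 1), F (j + 2) * ch (j + 2) := by
    rw [Finset.sum_range_succ', Finset.sum_range_succ']
    simp only [F]
    rw [hneg _ _ (by simp), hneg _ _ (by simp)]
    simp [add_assoc]
  have h1 : (2 * (r : ℤ) + 1) * p (n + 1) r =
      ∑ j ∈ Finset.range (n + 2), (B j * ch j + C (j + 1) * ch (j + 1)) := by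
    rw [hA, Finset.mul_sum]
    refine Finset.sum_congr rfl fun j hj => ?_
    have := choose_step_one n r j (by rw [Finset.mem_range] at hj; omega)
    simp only [B, C, ch]
    push_cast
    rw [add_sub_cancel_right]
    linear_combination A (n + 1) j * this
  have h2 : (2 * (r : ℤ) ^ 2 + 2 * r + n + 1) * p n r =
      ∑ j ∈ Finset.range (n + 1),
        (D j * ch j + E (j + 1) * ch (j + 1) + F (j + 2) * ch (j + 2)) := by
    rw [hA, Finset.mul_sum]
    refine Finset.sum_congr rfl fun j hj => ?_
    have := choose_step_two n r j (by rw [Finset.mem_range] at hj; omega)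
    simp only [D, E, F, ch]
    push_cast
    rw [add_sub_cancel_right, add_sub_cancel_right]
    linear_combination A n j * this
  have h3 := hp n r
  rw [hA (n + 2), h1, h2, Finset.mul_sum] at h3
  simp only [Finset.sum_add_distrib] at h3
  rw [← hB, ← hC, ← hD, ← hE, ← hF] at h3
  calc _ = ∑ j ∈ Finset.range (n + 3), ((n : ℤ) + 2) * (A (n + 2) j * ch j)
        - (∑ j ∈ Finset.range (n + 3), B j * ch j + ∑ j ∈ Finset.range (n + 3), C j * ch j
          + (∑ j ∈ Finset.range (n + 3), D j * ch j + ∑ j ∈ Finset.range (n + 3), E j * ch j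
          + ∑ j ∈ Finset.range (n + 3), F j * ch j)) := by
        simp only [← Finset.sum_add_distrib, ← Finset.sum_sub_distrib]
        exact Finset.sum_congr rfl fun j _ => by ring
    _ = 0 := by rw [sub_eq_zero]; exact h3

section InvariantWeights

open PowerSeries

theorem natCard_weights (α : Type*) [Fintype α] (n : ℕ) :
    Nat.card {m : α → ℕ // ∑ a, m a = n} = (Fintype.card α).multichoose n := by
  classical
  rw [← Nat.card_congr (Sym.equivNatSumOfFintype α n), Nat.card_eq_fintype_card,
    Sym.card_sym_eq_multichoose]

instance finite_weights (α : Type*) [Fintype α] (n : ℕ) : Finite {m : α → ℕ // ∑ a, m a = n} :=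
  by classical exact Finite.of_equiv _ (Sym.equivNatSumOfFintype α n)

theorem succ_mul_multichoose (m a : ℕ) :
    (a + 1) * m.multichoose (a + 1) = (m + a) * m.multichoose a := by
  rcases m with _ | m
  · rcases a with _ | a <;> simp
  rw [Nat.multichoose_eq, Nat.multichoose_eq, show m + 1 + (a + 1) - 1 = m + a + 1 by omega,
    show m + 1 + a - 1 = m + a by omega, mul_comm, ← Nat.add_one_mul_choose_eq]
  ring

/-- The generating series of `ℕ`-valued weights on a set of `m` elements by total weight. -/
noncomputable def weightSeries (m : ℕ) : ℤ⟦X⟧ := mk fun n => (m.multichoose n : ℤ)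

/-- The generating series of `ℕ`-valued weights on a set of `m` elements by twice the total
weight. -/
noncomputable def doubleWeightSeries (m : ℕ) : ℤ⟦X⟧ :=
  mk fun n => if Even n then (m.multichoose (n / 2) : ℤ) else 0

theorem derivative_weightSeries (m : ℕ) :
    (1 - X) * d⁄dX ℤ (weightSeries m) = (m : ℤ⟦X⟧) * weightSeries m := by
  ext n
  rw [← nsmul_eq_mul, sub_mul, one_mul, map_sub, coeff_derivative, map_nsmul]
  have h := succ_mul_multichoose m n
  zify at h
  rcases n with _ | n
  · simp [weightSeries, coeff_zero_X_mul]
  · rw [coeff_succ_X_mul, coeff_derivative]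
    simp only [weightSeries, coeff_mk]
    push_cast at h ⊢
    rw [nsmul_eq_mul]
    linear_combination h

theorem derivative_doubleWeightSeries (m : ℕ) :
    (1 - X ^ 2) * d⁄dX ℤ (doubleWeightSeries m) =
      (m : ℤ⟦X⟧) * (2 * (X * doubleWeightSeries m)) := by
  ext n
  rw [← nsmul_eq_mul, sub_mul, one_mul, map_sub, coeff_derivative, map_nsmul, two_mul, map_add,
    nsmul_eq_mul]
  rcases n with _ | _ | n
  · simp [doubleWeightSeries, coeff_zero_X_mul, pow_two, mul_assoc]
  · have h := succ_mul_multichoose m 0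
    simp [doubleWeightSeries, coeff_succ_X_mul, pow_two, mul_assoc, coeff_zero_X_mul]
  · rw [pow_two, mul_assoc, coeff_succ_X_mul, coeff_succ_X_mul, coeff_succ_X_mul, coeff_derivative]
    simp only [doubleWeightSeries, coeff_mk]
    rcases Nat.even_or_odd' n with ⟨c, rfl | rfl⟩
    · have h1 : ¬ Even (2 * c + 1 + 1 + 1) := by grind
      have h2 : ¬ Even (2 * c + 1) := by grind
      simp [h1, h2]
    · have h := succ_mul_multichoose m (c + 1)
      have h1 : Even (2 * c + 1 + 1 + 1 + 1) := by grind
      have h2 : Even (2 * c + 1 + 1) := by grind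
      rw [if_pos h1, if_pos h2, show (2 * c + 1 + 1 + 1 + 1) / 2 = c + 1 + 1 by omega,
        show (2 * c + 1 + 1) / 2 = c + 1 by omega]
      zify at h
      push_cast
      linear_combination 2 * h

/-- Weights on a finite linear order that are invariant under an involution `σ`, amount to
weights on the fixed points of `σ` together with weights on the points moved up by `σ`. -/
noncomputable def invariantWeightsEquiv {T : Type*} [Fintype T] [LinearOrder T] (σ : T → T)
    (hσ : Function.Involutive σ) :
    {m : T → ℕ // ∀ t, m (σ t) = m t} ≃ ({t // σ t = t} → ℕ) × ({t // t < σ t} → ℕ) where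
  toFun m := (fun t => m.1 t, fun t => m.1 t)
  invFun uv := ⟨fun t => if h : σ t = t then uv.1 ⟨t, h⟩ else
      if h' : t < σ t then uv.2 ⟨t, h'⟩ else uv.2 ⟨σ t, by
        rw [hσ t]; exact lt_of_le_of_ne (not_lt.1 h') h⟩, fun t => by
    rcases lt_trichotomy t (σ t) with h | h | h
    · simp [hσ t, h, h.ne, h.ne', h.not_gt]
    · simp [← h]
    · simp [hσ t, h, h.ne, h.ne', h.not_gt]⟩
  left_inv m := by
    ext t
    rcases lt_trichotomy t (σ t) with h | h | h
    · simp [h, h.ne']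
    · simp [← h]
    · simp [h.ne, h.not_gt, m.2]
  right_inv uv := by
    ext ⟨t, h⟩
    · simp [h]
    · simp [h, h.ne']

theorem sum_eq_of_invariant {T : Type*} [Fintype T] [LinearOrder T] (σ : T → T)
    (hσ : Function.Involutive σ) (m : T → ℕ) (hm : ∀ t, m (σ t) = m t) :
    ∑ t, m t = ∑ t : {t // σ t = t}, m t + 2 * ∑ t : {t // t < σ t}, m t := by
  have e1 : ∑ t : {t // σ t = t}, m t = ∑ t with σ t = t, m t :=
    (Finset.sum_subtype _ (by simp) m).symm
  have e2 : ∑ t : {t // t < σ t}, m t = ∑ t with t < σ t, m t :=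
    (Finset.sum_subtype _ (by simp) m).symm
  have e3 : ∑ t with t < σ t, m t = ∑ t with σ t < t, m t :=
    Finset.sum_bij' (fun t _ => σ t) (fun t _ => σ t) (by simp [hσ _]) (by simp [hσ _])
      (by simp [hσ _]) (by simp [hσ _]) (by simp [hm])
  rw [e1, e2, two_mul]
  nth_rewrite 2 [e3]
  simp only [Finset.sum_filter, ← Finset.sum_add_distrib]
  refine Finset.sum_congr rfl fun t _ => ?_
  rcases lt_trichotomy t (σ t) with h | h | h
  · simp [h, h.ne', h.not_gt]
  · simp [← h]
  · simp [h, h.ne, h.not_gt]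

/-- The weights of total weight `n` on `T` that are invariant under `σ`. -/
abbrev InvariantWeight {T : Type*} [Fintype T] (σ : T → T) (n : ℕ) : Type _ :=
  {m : T → ℕ // (∀ t, m (σ t) = m t) ∧ ∑ t, m t = n}

theorem natCard_invariantWeight {T : Type*} [Fintype T] [LinearOrder T] (σ : T → T)
    (hσ : Function.Involutive σ) (n : ℕ) :
    (Nat.card (InvariantWeight σ n) : ℤ) =
      coeff n (weightSeries (Nat.card {t // σ t = t}) *
        doubleWeightSeries (Nat.card {t // t < σ t})) := by
  have hd (α : Type _) [Fintype α] (c : ℕ) :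
      (Nat.card {v : α → ℕ // 2 * ∑ a, v a = c} : ℤ) =
        coeff c (doubleWeightSeries (Nat.card α)) := by
    simp only [doubleWeightSeries, coeff_mk]
    split_ifs with h
    · rw [Nat.card_eq_fintype_card (α := α), ← natCard_weights]
      obtain ⟨c, rfl⟩ := even_iff_exists_two_mul.1 h
      simp
    · have : IsEmpty {v : α → ℕ // 2 * ∑ a, v a = c} := ⟨fun v => h (by rw [← v.2]; simp)⟩
      simp
  have hfin (α : Type _) [Fintype α] (c : ℕ) : Finite {v : α → ℕ // 2 * ∑ a, v a = c} :=
    (finite_weights α (c / 2)).of_injective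
      (fun v => ⟨v.1, by have := v.2; omega⟩) fun v v' h => by
        ext1; simpa using h
  let f (m : InvariantWeight σ n) : Σ c : Finset.HasAntidiagonal.antidiagonal n,
      {u : {t // σ t = t} → ℕ // ∑ a, u a = c.1.1} ×
        {v : {t // t < σ t} → ℕ // 2 * ∑ a, v a = c.1.2} :=
    ⟨⟨(∑ t : {t // σ t = t}, m.1 t, 2 * ∑ t : {t // t < σ t}, m.1 t), by
      rw [Finset.HasAntidiagonal.mem_antidiagonal, ← sum_eq_of_invariant σ hσ m.1 m.2.1, m.2.2]⟩,
      ⟨fun t => m.1 t, rfl⟩, ⟨fun t => m.1 t, rfl⟩⟩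
  have hf : Function.Bijective f := by
    constructor
    · intro m m' h
      have h' := congrArg (fun x => (x.2.1.1, x.2.2.1)) h
      ext1
      exact congrArg (fun m : {m : T → ℕ // ∀ t, m (σ t) = m t} => m.1)
        ((invariantWeightsEquiv σ hσ).injective (a₁ := ⟨m.1, m.2.1⟩) (a₂ := ⟨m'.1, m'.2.1⟩) h')
    · rintro ⟨⟨⟨a, b⟩, hc⟩, ⟨u, hu⟩, ⟨v, hv⟩⟩
      dsimp only at hu hv
      subst hu hv
      obtain ⟨m, hm⟩ := (invariantWeightsEquiv σ hσ).surjective (u, v)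
      obtain ⟨rfl, rfl⟩ := Prod.ext_iff.1 hm
      exact ⟨⟨m.1, m.2, by
        rw [sum_eq_of_invariant σ hσ m.1 m.2, ← Finset.HasAntidiagonal.mem_antidiagonal.1 hc]
        rfl⟩, rfl⟩
  rw [Nat.card_congr (Equiv.ofBijective f hf), Nat.card_sigma, coeff_mul]
  push_cast
  refine Eq.trans (Finset.sum_congr rfl fun c _ => ?_) (Finset.sum_coe_sort _ _)
  rw [Nat.card_prod, natCard_weights, ← hd]
  simp [weightSeries]

theorem natCard_invariantWeight_succ_succ {T : Type*} [Fintype T] [LinearOrder T] (σ : T → T)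
    (hσ : Function.Involutive σ) (n : ℕ) :
    ((n : ℤ) + 2) * Nat.card (InvariantWeight σ (n + 2)) =
      Nat.card {t // σ t = t} * Nat.card (InvariantWeight σ (n + 1)) +
        (Nat.card T + n) * Nat.card (InvariantWeight σ n) := by
  have hT : Nat.card T = Nat.card {t // σ t = t} + 2 * Nat.card {t // t < σ t} := by
    simpa using sum_eq_of_invariant σ hσ (fun _ => 1) (fun _ => rfl)
  rw [hT]
  simp only [natCard_invariantWeight σ hσ]
  generalize Nat.card {t // σ t = t} = f
  generalize Nat.card {t // t < σ t} = s
  set F := weightSeries f * doubleWeightSeries s with hF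
  have hd : d⁄dX ℤ F = X ^ 2 * d⁄dX ℤ F + f • (F + X * F) + (2 * s) • (X * F) := by
    have h1 := derivative_weightSeries f
    have h2 := derivative_doubleWeightSeries s
    rw [hF, Derivation.leibniz]
    simp only [smul_eq_mul, nsmul_eq_mul]
    push_cast
    linear_combination (1 + X) * doubleWeightSeries s * h1 + weightSeries f * h2
  have := congrArg (coeff (n + 1)) hd
  rw [map_add, map_add, map_nsmul, map_nsmul, map_add, coeff_succ_X_mul, pow_two, mul_assoc,
    coeff_succ_X_mul, coeff_derivative] at this
  simp only [nsmul_eq_mul] at this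
  rcases n with _ | n
  · rw [coeff_zero_X_mul] at this
    push_cast at this ⊢
    linear_combination this
  · rw [coeff_succ_X_mul, coeff_derivative] at this
    push_cast at this ⊢
    linear_combination this

theorem natCard_invariantWeight_one {T : Type*} [Fintype T] [LinearOrder T] (σ : T → T)
    (hσ : Function.Involutive σ) :
    Nat.card (InvariantWeight σ 1) = Nat.card {t // σ t = t} := by
  zify
  rw [natCard_invariantWeight σ hσ]
  simp [coeff_mul, weightSeries, doubleWeightSeries, Finset.Nat.antidiagonal_succ]

end InvariantWeights

section LabelledInvolution

/-- Involutions `u` of `Fin n` together with a monotone labelling `τ` that `u` changes by `σ`,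
such that `u` is increasing on the fibres of `τ`. -/
@[ext]
structure LabelledInvolution {T : Type*} [LinearOrder T] (σ : T → T) (n : ℕ) where
  u : Fin n → Fin n
  τ : Fin n → T
  invol : Function.Involutive u
  map_u : ∀ x, τ (u x) = σ (τ x)
  mono : Monotone τ
  lt_of_lt : ∀ x y, x < y → τ x = τ y → u x < u y

variable {T : Type*} [LinearOrder T] {σ : T → T} {n : ℕ}

theorem eq_of_monotone_of_card_fiber {τ τ' : Fin n → T} (h : Monotone τ) (h' : Monotone τ')
    (hc : ∀ t, (Finset.univ.filter fun x => τ x = t).card =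
      (Finset.univ.filter fun x => τ' x = t).card) : τ = τ' := by
  apply List.ofFn_injective
  refine List.Perm.eq_of_sortedLE h.sortedLE_ofFn h'.sortedLE_ofFn (Multiset.coe_eq_coe.1 ?_)
  rw [← Fin.univ_val_map, ← Fin.univ_val_map]
  ext t
  rw [Multiset.count_map, Multiset.count_map]
  simp only [eq_comm (a := t)]
  exact hc t

namespace LabelledInvolution

variable [Fintype T]

/-- The sizes of the fibres of the labelling. -/
def weight (hσ : Function.Involutive σ) (p : LabelledInvolution σ n) : InvariantWeight σ n :=
  ⟨fun t => (Finset.univ.filter fun x => p.τ x = t).card, fun t =>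
    Finset.card_bij' (fun x _ => p.u x) (fun x _ => p.u x)
      (fun x hx => by
        have := (Finset.mem_filter.1 hx).2
        simp [p.map_u, this, hσ t])
      (fun x hx => by
        have := (Finset.mem_filter.1 hx).2
        simp [p.map_u, this])
      (fun x _ => p.invol x) (fun x _ => p.invol x), by
    rw [← Finset.card_eq_sum_card_fiberwise (f := p.τ) (s := Finset.univ) (by simp)]
    simp⟩

theorem weight_injective (hσ : Function.Involutive σ) :
    Function.Injective (weight hσ : LabelledInvolution σ n → _) := by
  rintro ⟨u, τ, hu, hτ, hm, hlt⟩ ⟨u', τ', hu', hτ', hm', hlt'⟩ h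
  obtain rfl : τ = τ' :=
    eq_of_monotone_of_card_fiber hm hm' fun t => congrFun (congrArg Subtype.val h) t
  congr 1
  ext1 x
  have hrange (v : Fin n → Fin n) (hv : Function.Involutive v) (hv' : ∀ x, τ (v x) = σ (τ x)) :
      Set.range (fun y : {y // τ y = τ x} => v y) = {z | τ z = σ (τ x)} := by
    ext z
    constructor
    · rintro ⟨⟨y, hy⟩, rfl⟩
      simp [hv', hy]
    · intro hz
      exact ⟨⟨v z, by rw [hv', hz, hσ]⟩, hv z⟩
  have := (StrictMono.range_inj (f := fun y : {y // τ y = τ x} => u y)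
    (g := fun y : {y // τ y = τ x} => u' y) (fun a b hab => hlt _ _ hab (a.2.trans b.2.symm))
    (fun a b hab => hlt' _ _ hab (a.2.trans b.2.symm))).1
    ((hrange u hu hτ).trans (hrange u' hu' hτ').symm)
  exact congrFun this ⟨x, rfl⟩

theorem weight_surjective (hσ : Function.Involutive σ) :
    Function.Surjective (weight hσ : LabelledInvolution σ n → _) := by
  rintro ⟨m, hm, hn⟩
  let S := {a : T ×ₗ ℕ // (ofLex a).2 < m (ofLex a).1}
  let fst (a : S) : T := (ofLex a.1).1
  let swap (a : S) : S := ⟨toLex (σ (ofLex a.1).1, (ofLex a.1).2), by simpa [hm] using a.2⟩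
  have hswap : Function.Involutive swap := fun a => by
    ext1
    simp [swap, hσ _]
  have hfst (a : S) : fst (swap a) = σ (fst a) := rfl
  have hlt (a b : S) (hab : a < b) (h : fst a = fst b) : swap a < swap b := by
    have hab : a.1 < b.1 := hab
    change (swap a).1 < (swap b).1
    rw [Prod.Lex.lt_iff] at hab ⊢
    rcases hab with hab | ⟨-, hab⟩
    · exact absurd h hab.ne
    · exact Or.inr ⟨congrArg σ h, hab⟩
  let eS : S ≃ Σ t, Fin (m t) :=
    { toFun := fun a => ⟨(ofLex a.1).1, (ofLex a.1).2, a.2⟩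
      invFun := fun b => ⟨toLex (b.1, b.2), b.2.2⟩
      left_inv := fun a => rfl
      right_inv := fun b => rfl }
  let _ : Fintype S := Fintype.ofEquiv _ eS.symm
  have hcard : Fintype.card S = n := by
    rw [Fintype.card_congr eS, Fintype.card_sigma, ← hn]
    simp
  let e := Fintype.orderIsoFinOfCardEq S hcard
  refine ⟨⟨fun x => e.symm (swap (e x)), fun x => fst (e x), fun x => ?_, fun x => ?_,
    fun x y h => ?_, fun x y h h' => ?_⟩, ?_⟩
  · simp [hswap _]
  · simp [hfst]
  · have h : (e x).1 ≤ (e y).1 := e.monotone h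
    rcases Prod.Lex.le_iff.1 h with h | ⟨h, -⟩
    · exact h.le
    · exact h.le
  · exact e.symm.strictMono (hlt _ _ (e.strictMono h) h')
  · ext t
    simp only [weight]
    rw [← Finset.card_range (m t)]
    symm
    refine Finset.card_bij (fun k hk => e.symm ⟨toLex (t, k), Finset.mem_range.1 hk⟩)
      (by simp [fst]) (fun a _ b _ h => ?_) fun x hx => ?_
    · exact congrArg (fun a : S => (ofLex a.1).2) (e.symm.injective h)
    · obtain rfl := (Finset.mem_filter.1 hx).2
      exact ⟨(ofLex (e x).1).2, Finset.mem_range.2 (e x).2, e.symm_apply_apply x⟩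

end LabelledInvolution

theorem natCard_labelledInvolution [Fintype T] (hσ : Function.Involutive σ) :
    Nat.card (LabelledInvolution σ n) = Nat.card (InvariantWeight σ n) :=
  Nat.card_eq_of_bijective _
    ⟨LabelledInvolution.weight_injective hσ, LabelledInvolution.weight_surjective hσ⟩

end LabelledInvolution

section SignedInvolution

/-- The labels `(i, s, j)`, where `s` is a sign (`false` being negative) and the sign is positive
if one of `i`, `j` is `0`. -/
abbrev SignedLabel (r : ℕ) : Type :=
  {t : Fin (r + 1) ×ₗ (Bool ×ₗ Fin (r + 1)) //
    (ofLex (ofLex t).2).1 = false → (ofLex t).1 ≠ 0 ∧ (ofLex (ofLex t).2).2 ≠ 0}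

namespace SignedLabel

variable {r : ℕ}

abbrev mk (i : Fin (r + 1)) (s : Bool) (j : Fin (r + 1)) (h : s = false → i ≠ 0 ∧ j ≠ 0) :
    SignedLabel r :=
  ⟨toLex (i, toLex (s, j)), h⟩

abbrev row (t : SignedLabel r) : Fin (r + 1) := (ofLex t.1).1

abbrev sign (t : SignedLabel r) : Bool := (ofLex (ofLex t.1).2).1

abbrev col (t : SignedLabel r) : Fin (r + 1) := (ofLex (ofLex t.1).2).2

def swap (t : SignedLabel r) : SignedLabel r :=
  mk t.col t.sign t.row fun h => (t.2 h).symm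

theorem swap_involutive : Function.Involutive (swap : SignedLabel r → _) := fun _ => rfl

theorem natCard : Nat.card (SignedLabel r) = 2 * r ^ 2 + 2 * r + 1 := by
  let f : (Fin (r + 1) × Fin (r + 1)) ⊕ (Fin r × Fin r) → SignedLabel r :=
    Sum.elim (fun p => mk p.1 true p.2 (by simp)) (fun p => mk p.1.succ false p.2.succ (by simp))
  have hf : Function.Bijective f := by
    constructor
    · rintro (⟨i, j⟩ | ⟨i, j⟩) (⟨i', j'⟩ | ⟨i', j'⟩) h <;>
        simpa [f] using congrArg Subtype.val h
    · rintro ⟨⟨i, s, j⟩, h⟩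
      rcases s with _ | _
      · obtain ⟨hi, hj⟩ := h rfl
        obtain ⟨i, rfl⟩ := Fin.exists_succ_eq.2 hi
        obtain ⟨j, rfl⟩ := Fin.exists_succ_eq.2 hj
        exact ⟨Sum.inr (i, j), rfl⟩
      · exact ⟨Sum.inl (i, j), rfl⟩
  rw [← Nat.card_eq_of_bijective f hf]
  simp
  ring

theorem natCard_fixed : Nat.card {t : SignedLabel r // swap t = t} = 2 * r + 1 := by
  let f : Fin (r + 1) ⊕ Fin r → {t : SignedLabel r // swap t = t} :=
    Sum.elim (fun i => ⟨mk i true i (by simp), rfl⟩)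
      (fun i => ⟨mk i.succ false i.succ (by simp), rfl⟩)
  have hf : Function.Bijective f := by
    constructor
    · rintro (i | i) (i' | i') h <;> simpa [f] using congrArg (fun t => t.1.1) h
    · rintro ⟨⟨⟨i, s, j⟩, h⟩, h'⟩
      obtain rfl : j = i := congrArg row h'
      rcases s with _ | _
      · obtain ⟨hi, -⟩ := h rfl
        obtain ⟨i, rfl⟩ := Fin.exists_succ_eq.2 hi
        exact ⟨Sum.inr i, rfl⟩
      · exact ⟨Sum.inl j, rfl⟩
  rw [← Nat.card_eq_of_bijective f hf]
  simp
  ring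

end SignedLabel

/-- Signed involutions of length `n`, encoded by absolute values and signs (`false` being
negative). -/
@[ext]
structure SignedInvolution (n : ℕ) where
  u : Fin n → Fin n
  s : Fin n → Bool
  invol : Function.Involutive u
  s_u : ∀ x, s (u x) = s x

/-- The values of a signed involution, ordered by `rlt`. -/
def SignedInvolution.key {n : ℕ} (p : SignedInvolution n) (x : Fin n) : Bool ×ₗ Fin n :=
  toLex (p.s x, p.u x)

/-- `f` is weakly increasing from `0`, and increases strictly at every descent of `p`. -/
def SignedInvolution.Compatible {n r : ℕ} (p : SignedInvolution n) (f : Fin n → Fin (r + 1)) :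
    Prop :=
  (∀ x y, x < y → f x < f y ∨ f x = f y ∧ p.key x < p.key y) ∧ ∀ x, p.s x = false → f x ≠ 0

theorem SignedInvolution.Compatible.monotone {n r : ℕ} {p : SignedInvolution n}
    {f : Fin n → Fin (r + 1)} (h : p.Compatible f) : Monotone f := fun x y hxy => by
  rcases hxy.eq_or_lt with rfl | hxy
  · exact le_rfl
  · rcases h.1 x y hxy with h | h
    · exact h.le
    · exact h.1.le

/-- A signed involution with a compatible sequence is the same as an involution labelled by
`SignedLabel`. -/
def compatibleEquiv (n r : ℕ) :
    {q : SignedInvolution n × (Fin n → Fin (r + 1)) // q.1.Compatible q.2} ≃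
      LabelledInvolution (SignedLabel.swap (r := r)) n where
  toFun q :=
    { u := q.1.1.u
      τ := fun x => SignedLabel.mk (q.1.2 x) (q.1.1.s x) (q.1.2 (q.1.1.u x)) fun h =>
        ⟨q.2.2 x h, q.2.2 _ ((q.1.1.s_u x).trans h)⟩
      invol := q.1.1.invol
      map_u := fun x => Subtype.ext <| Prod.ext rfl <|
        Prod.ext (q.1.1.s_u x) (congrArg q.1.2 (q.1.1.invol x))
      mono := fun x y hxy => by
        rcases hxy.eq_or_lt with rfl | hxy
        · exact le_rfl
        have := q.2.1 x y hxy
        rw [SignedInvolution.key, SignedInvolution.key, Prod.Lex.toLex_lt_toLex] at this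
        change toLex (q.1.2 x, toLex (q.1.1.s x, q.1.2 (q.1.1.u x))) ≤
          toLex (q.1.2 y, toLex (q.1.1.s y, q.1.2 (q.1.1.u y)))
        rw [Prod.Lex.toLex_le_toLex, Prod.Lex.toLex_le_toLex]
        rcases this with h | ⟨h, h' | ⟨h', h''⟩⟩
        · exact Or.inl h
        · exact Or.inr ⟨h, Or.inl h'⟩
        · exact Or.inr ⟨h, Or.inr ⟨h', q.2.monotone h''.le⟩⟩
      lt_of_lt := fun x y hxy h => by
        have := q.2.1 x y hxy
        rw [SignedInvolution.key, SignedInvolution.key, Prod.Lex.toLex_lt_toLex] at this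
        have h1 : q.1.2 x = q.1.2 y := congrArg SignedLabel.row h
        have h2 : q.1.1.s x = q.1.1.s y := congrArg SignedLabel.sign h
        simpa [h1, h2] using this }
  invFun p := ⟨(⟨p.u, fun x => (p.τ x).sign, p.invol, fun x => by rw [p.map_u]; rfl⟩,
      fun x => (p.τ x).row), by
    have hrow : Monotone fun x => (p.τ x).row := fun x y hxy => by
      have : (p.τ x).1 ≤ (p.τ y).1 := p.mono hxy
      rcases Prod.Lex.le_iff.1 this with h | h
      · exact h.le
      · exact h.1.le
    refine ⟨fun x y hxy => ?_, fun x h => ((p.τ x).2 h).1⟩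
    rw [SignedInvolution.key, SignedInvolution.key, Prod.Lex.toLex_lt_toLex]
    have : (p.τ x).1 ≤ (p.τ y).1 := p.mono hxy.le
    rw [Prod.Lex.le_iff, Prod.Lex.le_iff] at this
    rcases this with h | ⟨h, h' | ⟨h', h''⟩⟩
    · exact Or.inl h
    · exact Or.inr ⟨h, Or.inl h'⟩
    · refine Or.inr ⟨h, Or.inr ⟨h', ?_⟩⟩
      rcases h''.eq_or_lt with h'' | h''
      · refine p.lt_of_lt x y hxy ?_
        ext1
        exact Prod.ext h (Prod.ext h' h'')
      · refine hrow.reflect_lt ?_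
        change (p.τ (p.u x)).row < (p.τ (p.u y)).row
        rw [p.map_u, p.map_u]
        exact h''⟩
  left_inv q := rfl
  right_inv p := by
    refine LabelledInvolution.ext rfl (funext fun x => Subtype.ext ?_)
    exact Prod.ext rfl (Prod.ext rfl (congrArg SignedLabel.row (p.map_u x)))

end SignedInvolution

section CompatibleCount

theorem Fin.rel_of_lt_of_rel_succ {n : ℕ} {R : Fin n → Fin n → Prop}
    (htrans : ∀ x y z, R x y → R y z → R x z) (hsucc : ∀ x y : Fin n, (x : ℕ) + 1 = y → R x y)
    {x y : Fin n} (hxy : x < y) : R x y := by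
  obtain ⟨k, hk⟩ : ∃ k, (y : ℕ) = x + k + 1 := ⟨y - x - 1, by have : (x : ℕ) < y := hxy; omega⟩
  induction k generalizing y with
  | zero => exact hsucc _ _ hk.symm
  | succ k ih =>
    let z : Fin n := ⟨x + k + 1, by omega⟩
    exact htrans x z y (ih (y := z) (Fin.lt_def.2 (by simp only [z]; omega)) rfl)
      (hsucc z y (by simp only [z]; omega))

theorem Fin.add_le_add_of_strictMono {n m : ℕ} {g : Fin n → Fin m} (hg : StrictMono g)
    {x y : Fin n} (hxy : x ≤ y) : (g x : ℕ) + y ≤ g y + x := by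
  rcases hxy.eq_or_lt with rfl | hxy
  · exact le_rfl
  refine Fin.rel_of_lt_of_rel_succ (R := fun x y => (g x : ℕ) + y ≤ g y + x)
    (fun x y z h h' => by omega) (fun x y h => ?_) hxy
  have : (g x : ℕ) < g y := hg (Fin.lt_def.2 (by omega))
  omega

theorem Fin.val_le_of_strictMono {n m : ℕ} {g : Fin n → Fin m} (hg : StrictMono g) (x : Fin n) :
    (x : ℕ) ≤ g x := by
  let y : Fin n := ⟨0, x.pos⟩
  have h := Fin.add_le_add_of_strictMono hg (x := y) (y := x) (Fin.le_def.2 (by simp [y]))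
  simp only [y] at h
  omega

/-- Sequences in `{0, …, r}` which stay monotone after subtracting `d` are the same as strictly
increasing sequences. -/
def shiftEquiv {n : ℕ} (r D : ℕ) (d : Fin n → ℕ) (hd : ∀ x, d x ≤ D)
    (hlast : ∀ x : Fin n, (x : ℕ) + 1 = n → d x = D) :
    {f : Fin n → Fin (r + 1) // (∀ x, d x ≤ f x) ∧ ∀ x y, x ≤ y → (f x : ℕ) + d y ≤ f y + d x} ≃
      (Fin n ↪o Fin (n + r - D)) where
  toFun f := OrderEmbedding.ofStrictMono
    (fun x => ⟨f.1 x - d x + x, by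
      have hx := x.2
      let y : Fin n := ⟨n - 1, by omega⟩
      have h1 := hlast y (by simp only [y]; omega)
      have h2 := f.2.1 y
      have h3 := f.2.2 x y (Fin.le_def.2 (by simp only [y]; omega))
      have h4 := (f.1 y).2
      omega⟩)
    fun x y hxy => by
      have h1 := f.2.1 x
      have h2 := f.2.1 y
      have h3 := f.2.2 x y hxy.le
      have h4 : (x : ℕ) < y := hxy
      rw [Fin.lt_def]
      simp only
      omega
  invFun g := ⟨fun x => ⟨g x - x + d x, by
      have hx := x.2
      let y : Fin n := ⟨n - 1, by omega⟩
      have h1 := hd x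
      have h4 := hd y
      have h5 := hlast y (by simp only [y]; omega)
      have h2 : (g x : ℕ) + (n - 1) ≤ g y + x := Fin.add_le_add_of_strictMono g.strictMono
        (y := y) (Fin.le_def.2 (by simp only [y]; omega))
      have h3 := (g y).2
      have h6 := Fin.val_le_of_strictMono g.strictMono x
      omega⟩, fun x => by simp, fun x y hxy => by
      have h := Fin.add_le_add_of_strictMono g.strictMono hxy
      simp only
      omega⟩
  left_inv f := by
    ext x
    have := f.2.1 x
    change ((f.1 x : ℕ) - d x + x) - x + d x = f.1 x
    omega
  right_inv g := by
    ext x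
    have h := Fin.val_le_of_strictMono g.strictMono x
    simp
    omega

namespace SignedInvolution

variable {n r : ℕ} (p : SignedInvolution n)

theorem key_injective : Function.Injective p.key := fun _ _ h =>
  p.invol.injective (congrArg (fun t => (ofLex t).2) h)

/-- The value at `x` is smaller than its predecessor, which is `0` for the first position. -/
def IsDescent (x : Fin n) : Prop :=
  ((x : ℕ) = 0 → p.s x = false) ∧ ∀ y : Fin n, (y : ℕ) + 1 = x → p.key x < p.key y

noncomputable def des : ℕ :=
  (Finset.univ.filter fun x => p.IsDescent x).card

/-- The number of descents up to position `x`. -/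
noncomputable def desUpTo (x : Fin n) : ℕ :=
  ((Finset.Iic x).filter fun x => p.IsDescent x).card

theorem des_le : p.des ≤ n :=
  (Finset.card_filter_le _ _).trans (by simp)

theorem desUpTo_le (x : Fin n) : p.desUpTo x ≤ p.des :=
  Finset.card_le_card (Finset.filter_subset_filter _ (Finset.subset_univ _))

theorem desUpTo_last {x : Fin n} (hx : (x : ℕ) + 1 = n) : p.desUpTo x = p.des := by
  have : Finset.Iic x = Finset.univ := by
    refine Finset.ext fun y => ?_
    simp only [Finset.mem_Iic, Finset.mem_univ, iff_true, Fin.le_def]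
    omega
  rw [desUpTo, this, des]

theorem desUpTo_of_eq_zero {x : Fin n} (hx : (x : ℕ) = 0) :
    p.desUpTo x = if p.s x = false then 1 else 0 := by
  have h1 : Finset.Iic x = {x} := by
    refine Finset.ext fun y => ?_
    simp only [Finset.mem_Iic, Finset.mem_singleton, Fin.le_def, Fin.ext_iff]
    omega
  have h2 : p.IsDescent x ↔ p.s x = false :=
    ⟨fun h => h.1 hx, fun h => ⟨fun _ => h, fun y hy => by omega⟩⟩
  rw [desUpTo, h1, Finset.filter_singleton]
  simp only [h2]
  split_ifs <;> rfl

theorem desUpTo_of_succ_eq {x y : Fin n} (h : (x : ℕ) + 1 = y) :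
    p.desUpTo y = p.desUpTo x + if p.key y < p.key x then 1 else 0 := by
  have h1 : Finset.Iic y = insert y (Finset.Iic x) := by
    refine Finset.ext fun z => ?_
    simp only [Finset.mem_Iic, Finset.mem_insert, Fin.le_def, Fin.ext_iff]
    omega
  have h2 : p.IsDescent y ↔ p.key y < p.key x := by
    refine ⟨fun h' => h'.2 x h, fun h' => ⟨fun h0 => by omega, fun z hz => ?_⟩⟩
    obtain rfl : z = x := by ext; omega
    exact h'
  have h3 : y ∉ Finset.Iic x := by
    simp only [Finset.mem_Iic, Fin.le_def]
    omega
  rw [desUpTo, desUpTo, h1, Finset.filter_insert]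
  simp only [h2]
  split_ifs
  · rw [Finset.card_insert_of_notMem fun hy => h3 (Finset.mem_filter.1 hy).1]
  · rfl

theorem compatible_iff {f : Fin n → Fin (r + 1)} : p.Compatible f ↔
    (∀ x, p.desUpTo x ≤ f x) ∧
      ∀ x y, x ≤ y → (f x : ℕ) + p.desUpTo y ≤ f y + p.desUpTo x := by
  constructor
  · intro hf
    have h (x y : Fin n) (hxy : x ≤ y) : (f x : ℕ) + p.desUpTo y ≤ f y + p.desUpTo x := by
      rcases hxy.eq_or_lt with rfl | hxy
      · exact le_rfl
      refine Fin.rel_of_lt_of_rel_succ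
        (R := fun x y => (f x : ℕ) + p.desUpTo y ≤ f y + p.desUpTo x)
        (fun x y z h h' => by omega) (fun x y h => ?_) hxy
      have hlt : x < y := Fin.lt_def.2 (by omega)
      rw [p.desUpTo_of_succ_eq h]
      rcases hf.1 x y hlt with h' | ⟨h', h''⟩
      · have h' : (f x : ℕ) < f y := h'
        split_ifs <;> omega
      · rw [if_neg h''.asymm, h']
        omega
    refine ⟨fun x => ?_, h⟩
    let z : Fin n := ⟨0, x.pos⟩
    have h1 := h z x (Fin.le_def.2 (by simp [z]))
    have h2 := p.desUpTo_of_eq_zero (x := z) rfl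
    have h3 := hf.2 z
    split_ifs at h2 with hs
    · have : (f z : ℕ) ≠ 0 := fun h => h3 hs (Fin.ext h)
      omega
    · omega
  · rintro ⟨h0, h⟩
    have hlt (x y : Fin n) (hxy : x < y) : f x < f y ∨ f x = f y ∧ p.key x < p.key y := by
      refine Fin.rel_of_lt_of_rel_succ
        (R := fun x y => f x < f y ∨ f x = f y ∧ p.key x < p.key y)
        (fun x y z h h' => ?_) (fun x y hs => ?_) hxy
      · rcases h with h | ⟨h, h1⟩ <;> rcases h' with h' | ⟨h', h1'⟩
        · exact Or.inl (h.trans h')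
        · exact Or.inl (h' ▸ h)
        · exact Or.inl (h ▸ h')
        · exact Or.inr ⟨h.trans h', h1.trans h1'⟩
      · have hlt : x < y := Fin.lt_def.2 (by omega)
        have h1 := h x y hlt.le
        rw [p.desUpTo_of_succ_eq hs] at h1
        split_ifs at h1 with hk
        · exact Or.inl (Fin.lt_def.2 (by omega))
        · have hle : f x ≤ f y := Fin.le_def.2 (by omega)
          exact hle.lt_or_eq.imp_right fun h => ⟨h, lt_of_le_of_ne (not_lt.1 hk)
            fun hk => hlt.ne (p.key_injective hk)⟩
    refine ⟨hlt, fun x hs hx => ?_⟩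
    let z : Fin n := ⟨0, x.pos⟩
    have hz := p.desUpTo_of_eq_zero (x := z) rfl
    have hz' := h0 z
    have hfz : f z = 0 ∧ p.s z = false := by
      rcases (Fin.le_def.2 (by simp [z]) : z ≤ x).eq_or_lt with hzx | hzx
      · exact hzx ▸ ⟨hx, hs⟩
      · rcases hlt z x hzx with h' | ⟨h', h''⟩
        · rw [hx] at h'
          exact absurd h' (Fin.not_lt_zero _)
        · refine ⟨h'.trans hx, ?_⟩
          rw [key, key, Prod.Lex.toLex_lt_toLex, hs] at h''
          rcases h'' with h'' | ⟨h'', -⟩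
          · exact absurd h'' (by simp)
          · exact h''
    rw [if_pos hfz.2] at hz
    rw [hz, hfz.1] at hz'
    simp at hz'

theorem natCard_compatible : Nat.card {f : Fin n → Fin (r + 1) // p.Compatible f} =
    (n + r - p.des).choose n := by
  have e := (Equiv.subtypeEquivRight fun f : Fin n → Fin (r + 1) => p.compatible_iff (f := f)).trans
    ((shiftEquiv r p.des p.desUpTo p.desUpTo_le fun _ => p.desUpTo_last).trans
      Set.powersetCard.ofFinEmbEquiv)
  rw [Nat.card_congr e, Set.powersetCard.card, Nat.card_fin]

end SignedInvolution

end CompatibleCount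

section InkB

/-- The element `x + 1` of `{1, …, n}`, with a sign (`false` being negative). -/
def signedValue {n : ℕ} (b : Bool) (x : Fin n) : ℤ :=
  if b then (x : ℤ) + 1 else -((x : ℤ) + 1)

section signedValue

variable {n : ℕ} {b c : Bool} {x y : Fin n}

theorem signedValue_inj : signedValue b x = signedValue c y ↔ b = c ∧ x = y := by
  rcases b <;> rcases c <;> simp [signedValue, Fin.ext_iff] <;> omega

theorem neg_signedValue : -signedValue b x = signedValue (!b) x := by
  rcases b <;> simp [signedValue]

theorem mem_OmegaSet {a : ℤ} : a ∈ OmegaSet n ↔ ∃ q : Bool × Fin n, signedValue q.1 q.2 = a := by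
  constructor
  · rintro ⟨h1, h2⟩
    rw [Int.abs_eq_natAbs] at h1 h2
    refine ⟨(decide (0 < a), ⟨a.natAbs - 1, by omega⟩), ?_⟩
    by_cases h : 0 < a <;> simp [signedValue, h] <;> omega
  · rintro ⟨⟨b, x⟩, rfl⟩
    change 1 ≤ |signedValue b x| ∧ |signedValue b x| ≤ n
    have := x.2
    cases b <;> simp only [signedValue, Bool.false_eq_true, if_false, if_true,
      Int.abs_eq_natAbs] <;> omega

theorem rlt_signedValue :
    rlt (signedValue b x) (signedValue c y) ↔ toLex (b, x) < toLex (c, y) := by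
  rw [Prod.Lex.toLex_lt_toLex, Fin.lt_def]
  rcases b <;> rcases c <;> simp [rlt, signedValue, Bool.lt_iff, -Fin.val_fin_lt] <;> omega

theorem rlt_signedValue_zero : rlt (signedValue b x) 0 ↔ b = false := by
  rcases b <;> simp [rlt, signedValue] <;> omega

end signedValue

namespace SignedInvolution

variable {n : ℕ} (p : SignedInvolution n)

/-- The signed involution as a function on the integers. -/
noncomputable def toIntMap (a : ℤ) : ℤ :=
  if h : ∃ q : Bool × Fin n, signedValue q.1 q.2 = a then
    signedValue (h.choose.1 == p.s h.choose.2) (p.u h.choose.2)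
  else a

theorem toIntMap_signedValue (b : Bool) (x : Fin n) :
    p.toIntMap (signedValue b x) = signedValue (b == p.s x) (p.u x) := by
  have h : ∃ q : Bool × Fin n, signedValue q.1 q.2 = signedValue b x := ⟨(b, x), rfl⟩
  obtain ⟨h1, h2⟩ := signedValue_inj.1 h.choose_spec
  rw [toIntMap, dif_pos h, h1, h2]

theorem toIntMap_of_notMem {a : ℤ} (h : a ∉ OmegaSet n) : p.toIntMap a = a :=
  dif_neg fun h' => h (mem_OmegaSet.2 h')

theorem toIntMap_toIntMap (a : ℤ) : p.toIntMap (p.toIntMap a) = a := by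
  by_cases h : a ∈ OmegaSet n
  · obtain ⟨⟨b, x⟩, rfl⟩ := mem_OmegaSet.1 h
    simp only [toIntMap_signedValue, p.s_u, p.invol x]
    congr 1
    cases b <;> cases p.s x <;> rfl
  · rw [p.toIntMap_of_notMem h, p.toIntMap_of_notMem h]

theorem isSignedInvolution_toIntMap : IsSignedInvolution n p.toIntMap := by
  have hmaps : Set.MapsTo p.toIntMap (OmegaSet n) (OmegaSet n) := fun a h => by
    obtain ⟨⟨b, x⟩, rfl⟩ := mem_OmegaSet.1 h
    exact mem_OmegaSet.2 ⟨(_, _), (p.toIntMap_signedValue b x).symm⟩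
  refine ⟨⟨fun a => ?_, ?_, fun a => p.toIntMap_of_notMem⟩, p.toIntMap_toIntMap⟩
  · by_cases h : a ∈ OmegaSet n
    · obtain ⟨⟨b, x⟩, rfl⟩ := mem_OmegaSet.1 h
      simp only [neg_signedValue, toIntMap_signedValue]
      congr 1
      cases b <;> cases p.s x <;> rfl
    · have h' : -a ∉ OmegaSet n := by simpa [OmegaSet] using h
      rw [p.toIntMap_of_notMem h, p.toIntMap_of_notMem h']
  · exact Set.InvOn.bijOn ⟨fun a _ => p.toIntMap_toIntMap a, fun a _ => p.toIntMap_toIntMap a⟩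
      hmaps hmaps

theorem toIntMap_injective : Function.Injective (toIntMap : SignedInvolution n → ℤ → ℤ) := by
  intro p q h
  have h' (x : Fin n) := congrFun h (signedValue true x)
  simp only [toIntMap_signedValue, signedValue_inj, Bool.true_beq] at h'
  exact SignedInvolution.ext (funext fun x => (h' x).2) (funext fun x => (h' x).1)

theorem exists_toIntMap_eq {w : ℤ → ℤ} (hw : IsSignedInvolution n w) :
    ∃ p : SignedInvolution n, p.toIntMap = w := by
  obtain ⟨⟨hodd, hbij, hid⟩, hinvol⟩ := hw
  have hex (x : Fin n) : ∃ q : Bool × Fin n, signedValue q.1 q.2 = w (signedValue true x) :=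
    mem_OmegaSet.1 (hbij.mapsTo (mem_OmegaSet.2 ⟨(true, x), rfl⟩))
  choose q hq using hex
  have hwq (b : Bool) (x : Fin n) :
      w (signedValue b x) = signedValue (b == (q x).1) (q x).2 := by
    cases b
    · rw [← Bool.not_true, ← neg_signedValue, hodd, ← hq, neg_signedValue]
      simp
    · rw [← hq, Bool.true_beq]
  have hqq (x : Fin n) : ((q x).1 == (q (q x).2).1) = true ∧ (q (q x).2).2 = x := by
    rw [← signedValue_inj, ← hwq, hq, hinvol]
  refine ⟨⟨fun x => (q x).2, fun x => (q x).1, fun x => (hqq x).2, fun x => ?_⟩, ?_⟩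
  · have := (hqq x).1
    simp at this
    exact this.symm
  · ext1 a
    by_cases h : a ∈ OmegaSet n
    · obtain ⟨⟨b, x⟩, rfl⟩ := mem_OmegaSet.1 h
      rw [toIntMap_signedValue, hwq]
    · rw [toIntMap_of_notMem _ h, hid a h]

theorem isDescent_iff (x : Fin n) :
    p.IsDescent x ↔ rlt (p.toIntMap ((x : ℕ) + 1)) (p.toIntMap (x : ℕ)) := by
  have hval (y : Fin n) : p.toIntMap ((y : ℕ) + 1) = signedValue (p.s y) (p.u y) := by
    have := p.toIntMap_signedValue true y
    rwa [Bool.true_beq] at this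
  rw [hval]
  rcases Nat.eq_zero_or_pos x with hx | hx
  · have h0 : p.toIntMap 0 = 0 := p.toIntMap_of_notMem (by simp [OmegaSet])
    rw [hx, Nat.cast_zero, h0, rlt_signedValue_zero]
    exact ⟨fun h => h.1 hx, fun h => ⟨fun _ => h, fun y hy => by omega⟩⟩
  · obtain ⟨y, hy⟩ : ∃ y : Fin n, (y : ℕ) + 1 = x := ⟨⟨x - 1, by omega⟩, Nat.sub_add_cancel hx⟩
    rw [← hy, Nat.cast_succ, hval, rlt_signedValue]
    refine ⟨fun h => h.2 y hy, fun h => ⟨fun h0 => by omega, fun z hz => ?_⟩⟩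
    obtain rfl : z = y := by ext; omega
    exact h

theorem desB_toIntMap : desB n p.toIntMap = p.des := by
  symm
  refine Finset.card_bij (fun x _ => (x : ℕ)) (fun x hx => ?_) (fun x _ y _ h => Fin.ext h)
    fun i hi => ?_
  · exact Finset.mem_filter.2 ⟨Finset.mem_range.2 x.2,
      (p.isDescent_iff x).1 (Finset.mem_filter.1 hx).2⟩
  · obtain ⟨h1, h2⟩ := Finset.mem_filter.1 hi
    exact ⟨⟨i, Finset.mem_range.1 h1⟩,
      Finset.mem_filter.2 ⟨Finset.mem_univ _, (p.isDescent_iff _).2 h2⟩, rfl⟩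

instance : Finite (SignedInvolution n) :=
  Finite.of_injective (fun p : SignedInvolution n => (p.u, p.s)) fun _ _ h =>
    SignedInvolution.ext (congrArg Prod.fst h) (congrArg Prod.snd h)

noncomputable instance : Fintype (SignedInvolution n) :=
  Fintype.ofFinite _

end SignedInvolution

theorem InkB_eq_card (n k : ℕ) :
    InkB n k = (Finset.univ.filter fun p : SignedInvolution n => p.des = k).card := by
  have : {w : ℤ → ℤ | IsSignedInvolution n w ∧ desB n w = k} =
      SignedInvolution.toIntMap '' {p : SignedInvolution n | p.des = k} := by
    ext w
    constructor
    · rintro ⟨hw, hk⟩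
      obtain ⟨p, rfl⟩ := SignedInvolution.exists_toIntMap_eq hw
      exact ⟨p, p.desB_toIntMap.symm.trans hk, rfl⟩
    · rintro ⟨p, hk, rfl⟩
      exact ⟨p.isSignedInvolution_toIntMap, p.desB_toIntMap.trans hk⟩
  rw [InkB, this, Set.ncard_image_of_injective _ SignedInvolution.toIntMap_injective,
    ← Set.ncard_coe_finset]
  simp

theorem InkB_eq_zero {n k : ℕ} (h : n < k) : InkB n k = 0 := by
  rw [InkB_eq_card, Finset.card_eq_zero, Finset.filter_eq_empty_iff]
  intro p _ hp
  have := p.des_le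
  omega

theorem natCard_invariantWeight_swap (n r : ℕ) :
    Nat.card (InvariantWeight (SignedLabel.swap (r := r)) n) =
      ∑ k ∈ Finset.range (n + 1), InkB n k * (n + r - k).choose n := by
  rw [← natCard_labelledInvolution SignedLabel.swap_involutive,
    ← Nat.card_congr (compatibleEquiv n r),
    Nat.card_congr (Equiv.subtypeProdEquivSigmaSubtype fun (p : SignedInvolution n)
      (f : Fin n → Fin (r + 1)) => p.Compatible f), Nat.card_sigma]
  simp only [SignedInvolution.natCard_compatible]
  rw [← Finset.sum_fiberwise_of_maps_to (g := SignedInvolution.des)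
    (t := Finset.range (n + 1)) fun p _ => Finset.mem_range.2 (Nat.lt_succ_of_le p.des_le)]
  refine Finset.sum_congr rfl fun k _ => ?_
  rw [InkB_eq_card, ← smul_eq_mul, ← Finset.sum_const]
  exact Finset.sum_congr rfl fun p hp => by rw [(Finset.mem_filter.1 hp).2]

end InkB

/-- Theorem 4.2 (main result): for every positive integer `n`, the sequence
`I_{n,0}^B, I_{n,1}^B, …, I_{n,n}^B` is unimodal; more precisely, `I_{n,k-1}^B ≤ I_{n,k}^B` for
all `1 ≤ k ≤ ⌊n/2⌋`, and `I_{n,k}^B ≥ I_{n,k+1}^B` for all `⌈n/2⌉ ≤ k ≤ n - 1`. -/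
theorem InkB_unimodal (n : ℕ) (hn : 1 ≤ n) :
    (∀ k : ℕ, 1 ≤ k → k ≤ n / 2 → InkB n (k - 1) ≤ InkB n k) ∧
      (∀ k : ℕ, (n + 1) / 2 ≤ k → k ≤ n - 1 → InkB n (k + 1) ≤ InkB n k) := by
  let A (n : ℕ) (k : ℤ) : ℤ := if 0 ≤ k then InkB n k.toNat else 0
  have hA (n k : ℕ) : A n k = InkB n k := by simp [A]
  have hneg (n : ℕ) (k : ℤ) (hk : k < 0) : A n k = 0 := if_neg (not_le.2 hk)
  have hlarge (n : ℕ) (k : ℤ) (hk : n < k) : A n k = 0 := by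
    lift k to ℕ using by omega
    rw [hA, InkB_eq_zero (by exact_mod_cast hk), Nat.cast_zero]
  have hsum (n r : ℕ) : (Nat.card (InvariantWeight (SignedLabel.swap (r := r)) n) : ℤ) =
      ∑ k ∈ Finset.range (n + 1), A n k * ((n + r - k).choose n : ℤ) := by
    rw [natCard_invariantWeight_swap]
    push_cast
    simp only [hA]
  have hone (r : ℕ) : 2 * (r : ℤ) + 1 =
      ∑ k ∈ Finset.range 2, A 1 k * ((1 + r - k).choose 1 : ℤ) := by
    rw [← hsum, natCard_invariantWeight_one _ SignedLabel.swap_involutive,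
      SignedLabel.natCard_fixed]
    push_cast
    rfl
  have h10 : A 1 0 = 1 := by simpa [Finset.sum_range_succ] using (hone 0).symm
  have h11 : A 1 1 = 1 := by
    have := hone 1
    simp [Finset.sum_range_succ, h10] at this
    omega
  have hrec := recurrence_of_choose_expansion A _ hneg hlarge hsum fun n r => by
    rw [natCard_invariantWeight_succ_succ _ SignedLabel.swap_involutive, SignedLabel.natCard_fixed,
      SignedLabel.natCard]
    push_cast
    ring
  obtain ⟨hsymm, hmono⟩ := unimodal_of_recurrence A hneg
    (fun n k => by simp only [A]; split_ifs <;> positivity)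
    (fun k => by
      rcases lt_trichotomy k 0 with hk | rfl | hk
      · rw [hneg 0 k hk, hlarge 0 (-k) (by simpa using hk)]
      · rfl
      · rw [hneg 0 (-k) (by omega), hlarge 0 k (by simpa using hk)])
    (fun k => by
      rcases lt_or_ge k 0 with hk | hk
      · rw [hneg 1 k hk, hlarge 1 (1 - k) (by push_cast; omega)]
      rcases lt_or_ge 1 k with hk' | hk'
      · rw [hneg 1 (1 - k) (by omega), hlarge 1 k (by simpa using hk')]
      obtain rfl | rfl : k = 0 ∨ k = 1 := by omega
      · rw [h10, sub_zero, h11]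
      · rw [h11, sub_self, h10]) hrec n
  constructor
  · intro k hk hkn
    have := hmono k (by omega)
    rw [← Nat.cast_one, ← Nat.cast_sub hk, hA, hA] at this
    exact_mod_cast this
  · intro k hk hkn
    have := hmono (n - k) (by omega)
    rw [← hsymm, show (n : ℤ) - k - 1 = n - (k + 1 : ℕ) by push_cast; ring, ← hsymm, hA,
      hA] at this
    exact_mod_cast this
end

section
/- (Inequality (15) in the proof of Theorem 4.2) For every integer n ≥ 3 and every 0 ≤ k ≤ ⌊n/2⌋, (2k+1)·I_{n−1,k}^B + (2n−4k+2)·I_{n−1,k−1}^B + (−2n+2k−3)·I_{n−1,k−2}^B ≥ 0, with the convention I_{m,j}^B = 0 for j < 0. -/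
open scoped Classical

/-- `I_{n,k}^B` extended by `0` for negative `k`, as an integer. -/
noncomputable def IZ (n : ℕ) (k : ℤ) : ℤ :=
  if 0 ≤ k then (InkB n k.toNat : ℤ) else 0

/-! ### Backward differences -/

/-- The backward difference of a function on the integers. -/
def bdiff (f : ℤ → ℤ) (j : ℤ) : ℤ := f j - f (j - 1)

lemma iterate_bdiff_succ (f : ℤ → ℤ) (m : ℕ) (k : ℤ) :
    bdiff^[m + 1] f k = bdiff^[m] f k - bdiff^[m] f (k - 1) := by
  rw [Function.iterate_succ_apply']
  rfl

lemma iterate_bdiff_add (f g : ℤ → ℤ) (m : ℕ) (k : ℤ) :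
    bdiff^[m] (fun j => f j + g j) k = bdiff^[m] f k + bdiff^[m] g k := by
  induction m generalizing k with
  | zero => rfl
  | succ m ih => simp only [iterate_bdiff_succ, ih]; ring

lemma iterate_bdiff_const_mul (c : ℤ) (f : ℤ → ℤ) (m : ℕ) (k : ℤ) :
    bdiff^[m] (fun j => c * f j) k = c * bdiff^[m] f k := by
  induction m generalizing k with
  | zero => rfl
  | succ m ih => simp only [iterate_bdiff_succ, ih]; ring

lemma iterate_bdiff_sum {ι : Type*} (s : Finset ι) (f : ι → ℤ → ℤ) (m : ℕ) (k : ℤ) :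
    bdiff^[m] (fun j => ∑ i ∈ s, f i j) k = ∑ i ∈ s, bdiff^[m] (f i) k := by
  induction m generalizing k with
  | zero => rfl
  | succ m ih => simp only [iterate_bdiff_succ, ih, Finset.sum_sub_distrib]

lemma iterate_bdiff_shift (f : ℤ → ℤ) (c : ℤ) (m : ℕ) (k : ℤ) :
    bdiff^[m] (fun j => f (j - c)) k = bdiff^[m] f (k - c) := by
  induction m generalizing k with
  | zero => rfl
  | succ m ih => simp only [iterate_bdiff_succ, ih]; rw [sub_right_comm]

lemma iterate_bdiff_id_mul (f : ℤ → ℤ) (m : ℕ) (k : ℤ) :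
    bdiff^[m + 1] (fun j => j * f j) k =
      k * bdiff^[m + 1] f k + (m + 1) * bdiff^[m] f (k - 1) := by
  induction m generalizing k with
  | zero => simp [bdiff]; ring
  | succ m ih =>
    rw [iterate_bdiff_succ, ih, ih, iterate_bdiff_succ f (m + 1), iterate_bdiff_succ f m (k - 1)]
    push_cast
    ring

/-- The binomial coefficient `(m + j).choose m`, extended by zero to negative `j`. -/
def binomExt (m : ℕ) (j : ℤ) : ℤ := if 0 ≤ j then ((m + j.toNat).choose m : ℕ) else 0

lemma bdiff_binomExt_succ (m : ℕ) : bdiff (binomExt (m + 1)) = binomExt m := by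
  funext j
  unfold bdiff binomExt
  rcases lt_trichotomy j 0 with h | rfl | h
  · rw [if_neg (by omega), if_neg (by omega), if_neg (by omega), sub_zero]
  · simp
  · obtain ⟨t, rfl⟩ : ∃ t : ℕ, j = t + 1 := ⟨(j - 1).toNat, by omega⟩
    rw [if_pos (by omega), if_pos (by omega), if_pos (by omega),
      show ((t : ℤ) + 1).toNat = t + 1 by omega, show ((t : ℤ) + 1 - 1).toNat = t by omega,
      show m + 1 + (t + 1) = (m + 1 + t) + 1 by ring, Nat.choose_succ_succ,
      show m + (t + 1) = m + 1 + t by ring]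
    push_cast
    ring

lemma iterate_bdiff_binomExt (m : ℕ) (j : ℤ) :
    bdiff^[m + 1] (binomExt m) j = if j = 0 then 1 else 0 := by
  induction m with
  | zero =>
    simp only [zero_add, Function.iterate_one, bdiff, binomExt]
    rcases lt_trichotomy j 0 with h | rfl | h
    · rw [if_neg (by omega), if_neg (by omega), if_neg (by omega), sub_zero]
    · simp
    · rw [if_pos (by omega), if_pos (by omega), if_neg (by omega)]
      simp
  | succ m ih => rw [Function.iterate_succ_apply, bdiff_binomExt_succ, ih]

/-! ### From a three-term recurrence to unimodality -/

/-- The three-term recurrence satisfied by the numbers of signed involutions with given number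
of descents. -/
def DescentRecurrence (a : ℕ → ℤ → ℤ) : Prop :=
  ∀ (n : ℕ) (k : ℤ), ((n : ℤ) + 2) * a (n + 2) k =
    (2 * k + 1) * a (n + 1) k + (2 * n - 2 * k + 5) * a (n + 1) (k - 1) +
    (2 * k ^ 2 + 2 * k + n + 1) * a n k +
    (4 * k * (n + 2) - 4 * k ^ 2 - 2 * (n + 2) + 2) * a n (k - 1) +
    (2 * (n + 3 - k) * (n + 2 - k) + n + 1) * a n (k - 2)

lemma descentRecurrence_of_samples {a N : ℕ → ℤ → ℤ}
    (ha : ∀ n k, bdiff^[n + 1] (N n) k = a n k)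
    (hN : ∀ (n : ℕ) (j : ℤ), ((n : ℤ) + 2) * N (n + 2) j =
      (2 * j + 1) * N (n + 1) j + (2 * j ^ 2 + 2 * j + 1 + n) * N n j) :
    DescentRecurrence a := by
  intro n k
  have h1 (k : ℤ) : bdiff^[n + 2] (N n) k = a n k - a n (k - 1) := by
    rw [iterate_bdiff_succ, ha, ha]
  have h2 (k : ℤ) : bdiff^[n + 3] (N n) k = a n k - 2 * a n (k - 1) + a n (k - 2) := by
    rw [iterate_bdiff_succ, h1, h1, sub_sub k]; norm_num; ring
  have h3 (k : ℤ) : bdiff^[n + 3] (N (n + 1)) k = a (n + 1) k - a (n + 1) (k - 1) := by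
    rw [iterate_bdiff_succ, ha, ha]
  have key : bdiff^[n + 3] (fun j => ((n : ℤ) + 2) * N (n + 2) j) k =
      bdiff^[n + 3] (fun j => (2 * (j * N (n + 1) j) + N (n + 1) j) +
        (2 * (j * (j * N n j)) + (2 * (j * N n j) + (1 + n) * N n j))) k := by
    refine congrArg (fun f => bdiff^[n + 3] f k) (funext fun j => ?_)
    rw [hN]; ring
  rw [iterate_bdiff_const_mul, ha] at key
  rw [key]
  simp only [iterate_bdiff_add, iterate_bdiff_const_mul, iterate_bdiff_id_mul, h1, h2, h3, ha]
  rw [sub_sub k]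
  push_cast
  ring

lemma DescentRecurrence.symm {a : ℕ → ℤ → ℤ} (h : DescentRecurrence a)
    (h0 : ∀ k, a 0 (-k) = a 0 k) (h1 : ∀ k, a 1 (1 - k) = a 1 k) (n : ℕ) (k : ℤ) :
    a n (n - k) = a n k := by
  induction n using Nat.twoStepInduction generalizing k with
  | zero => simpa using h0 k
  | one => simpa using h1 k
  | more n ih0 ih1 =>
    have e1 := h n k
    have e2 := h n (n + 2 - k)
    have s1 := ih1 (k - 1)
    have s2 := ih1 k
    have s3 := ih0 (k - 2)
    have s4 := ih0 (k - 1)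
    have s5 := ih0 k
    push_cast at s1 s2 ⊢
    rw [show (n : ℤ) + 1 - (k - 1) = n + 2 - k by ring] at s1
    rw [show (n : ℤ) - (k - 2) = n + 2 - k by ring] at s3
    rw [show (n : ℤ) - (k - 1) = n + 2 - k - 1 by ring] at s4
    rw [show (n : ℤ) + 1 - k = n + 2 - k - 1 by ring] at s2
    rw [show (n : ℤ) - k = n + 2 - k - 2 by ring] at s5
    rw [s1, s2, s3, s4, s5] at e2
    have hn : ((n : ℤ) + 2) ≠ 0 := by omega
    apply mul_left_cancel₀ hn
    rw [e1, e2]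
    ring

lemma DescentRecurrence.le_of_two_mul_le {a : ℕ → ℤ → ℤ} (h : DescentRecurrence a)
    (hneg : ∀ n k, k < 0 → a n k = 0) (hnonneg : ∀ n k, 0 ≤ a n k)
    (hsymm : ∀ (n : ℕ) (k : ℤ), a n (n - k) = a n k) (n : ℕ) (k : ℤ) (hk : 2 * k ≤ n + 1) :
    a n (k - 1) ≤ a n k := by
  induction n using Nat.twoStepInduction generalizing k with
  | zero => rw [hneg _ _ (by push_cast at hk; omega)]; exact hnonneg _ _
  | one =>
    rcases lt_or_ge k 1 with hk1 | hk1
    · rw [hneg _ _ (by omega)]; exact hnonneg _ _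
    · obtain rfl : k = 1 := by push_cast at hk; omega
      have := hsymm 1 1
      simp at this ⊢
      exact this.le
  | more n ih0 ih1 =>
    rcases lt_or_ge k 1 with hk1 | hk1
    · rw [hneg _ _ (by omega)]; exact hnonneg _ _
    push_cast at hk
    rcases eq_or_lt_of_le hk with hk2 | hk2
    · have := hsymm (n + 2) k
      rw [show (((n + 2 : ℕ) : ℤ) - k) = k - 1 by push_cast; omega] at this
      exact this.le
    have e1 := h n k
    have e2 := h n (k - 1)
    have u1 := ih1 k (by push_cast; omega)
    have u2 := ih1 (k - 1) (by push_cast; omega)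
    have v2 := ih0 (k - 1) (by omega)
    have v3 := ih0 (k - 2) (by omega)
    rw [show k - 1 - 1 = k - 2 by ring] at u2 v2 e2
    rw [show k - 2 - 1 = k - 3 by ring] at v3
    rw [show k - 1 - 2 = k - 3 by ring] at e2
    have hn : (0 : ℤ) < n + 2 := by omega
    refine le_of_mul_le_mul_left ?_ hn
    rw [e1, e2, ← sub_nonneg]
    have hα : (0 : ℤ) ≤ 2 * k ^ 2 + 2 * k + n + 1 := by positivity
    have c1 : 0 ≤ (2 * k + 1) * (a (n + 1) k - a (n + 1) (k - 1)) :=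
      mul_nonneg (by omega) (by omega)
    have c2 : 0 ≤ (2 * (n : ℤ) - 2 * k + 7) * (a (n + 1) (k - 1) - a (n + 1) (k - 2)) :=
      mul_nonneg (by omega) (by omega)
    have c3 : 0 ≤ (2 * (n + 4 - k) * (n + 3 - k) + n + 1) * (a n (k - 2) - a n (k - 3)) := by
      refine mul_nonneg ?_ (by omega)
      have : 0 ≤ 2 * ((n : ℤ) + 4 - k) * (n + 3 - k) := mul_nonneg (by omega) (by omega)
      omega
    have c4 : 0 ≤ (2 * k ^ 2 + 2 * k + n + 1) * (a n k - a n (k - 1)) +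
        (4 * k * (n + 2 - k) + 4 * k - 2 * n - 2) * (a n (k - 1) - a n (k - 2)) := by
      rcases eq_or_lt_of_le (show 2 * k ≤ n + 2 by omega) with hk3 | hk3
      · have s := hsymm n k
        rw [show (n : ℤ) - k = k - 2 by omega] at s
        rw [← s]
        have hn : (n : ℤ) = 2 * k - 2 := by omega
        rw [hn]
        have : 0 ≤ (2 * k ^ 2 - 4 * k + 3) * (a n (k - 1) - a n (k - 2)) :=
          mul_nonneg (by nlinarith [sq_nonneg (k - 1)]) (by omega)
        linarith
      · have v1 := ih0 k (by omega)
        refine add_nonneg (mul_nonneg hα (by omega)) (mul_nonneg ?_ (by omega))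
        nlinarith [mul_nonneg (show 0 ≤ k - 1 by omega) (show 0 ≤ (n : ℤ) + 1 - k by omega)]
    linarith

/-! ### Symmetric multisets of pairs -/

lemma succ_mul_multichoose_succ (d n : ℕ) :
    (n + 1) * d.multichoose (n + 1) = (d + n) * d.multichoose n := by
  rw [Nat.multichoose_eq, Nat.multichoose_eq]
  rcases Nat.eq_zero_or_pos (d + n) with h | h
  · obtain ⟨rfl, rfl⟩ : d = 0 ∧ n = 0 := by omega
    rfl
  · obtain ⟨t, ht⟩ : ∃ t, d + n = t + 1 := ⟨d + n - 1, by omega⟩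
    rw [← Nat.add_assoc, ht, Nat.add_sub_cancel, Nat.add_sub_cancel, Nat.add_one_mul_choose_eq,
      mul_comm]

open PowerSeries in
lemma sum_antidiagonal_recurrence {A B : ℕ → ℤ} {d e : ℤ}
    (hA : ∀ n : ℕ, (n + 1) * A (n + 1) = (d + n) * A n) (hB1 : B 1 = 0)
    (hB : ∀ n : ℕ, (n + 2) * B (n + 2) = (2 * e + n) * B n) (n : ℕ) :
    ((n : ℤ) + 2) * ∑ p ∈ Finset.HasAntidiagonal.antidiagonal (n + 2), A p.1 * B p.2 =
      d * ∑ p ∈ Finset.HasAntidiagonal.antidiagonal (n + 1), A p.1 * B p.2 +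
      (d + 2 * e + n) * ∑ p ∈ Finset.HasAntidiagonal.antidiagonal n, A p.1 * B p.2 := by
  have odeA : (1 - X) * derivative ℤ (mk A) = C d * mk A := by
    ext n
    rw [sub_mul, one_mul, map_sub, coeff_C_mul, coeff_derivative, coeff_mk, coeff_mk]
    rcases n with _ | n
    · rw [coeff_zero_X_mul]
      linear_combination hA 0
    · rw [coeff_succ_X_mul, coeff_derivative, coeff_mk]
      linear_combination (norm := (push_cast; ring)) hA (n + 1)
  have odeB : (1 - X ^ 2) * derivative ℤ (mk B) = C (2 * e) * (X * mk B) := by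
    ext n
    rw [sub_mul, one_mul, map_sub, coeff_C_mul, coeff_derivative, coeff_mk, pow_two, mul_assoc]
    rcases n with _ | _ | n
    · rw [coeff_zero_X_mul, coeff_zero_X_mul]
      simp [hB1]
    · rw [coeff_succ_X_mul, coeff_zero_X_mul, coeff_succ_X_mul, coeff_mk]
      linear_combination (norm := (push_cast; ring)) hB 0
    · rw [coeff_succ_X_mul, coeff_succ_X_mul, coeff_succ_X_mul, coeff_derivative, coeff_mk]
      linear_combination (norm := (push_cast; ring)) hB (n + 1)
  have ode : derivative ℤ (mk A * mk B) - X * (X * derivative ℤ (mk A * mk B)) =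
      C d * (mk A * mk B) + C (d + 2 * e) * (X * (mk A * mk B)) := by
    rw [Derivation.leibniz, smul_eq_mul, smul_eq_mul, map_add]
    linear_combination (1 + X) * mk B * odeA + mk A * odeB
  have hcoeff (n : ℕ) : coeff n (mk A * mk B) =
      ∑ p ∈ Finset.HasAntidiagonal.antidiagonal n, A p.1 * B p.2 := by
    simp only [coeff_mul, coeff_mk]
  have key := congrArg (coeff (n + 1)) ode
  rw [map_sub, map_add, coeff_C_mul, coeff_C_mul, coeff_succ_X_mul, coeff_succ_X_mul,
    coeff_derivative] at key
  simp only [← hcoeff]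
  rcases n with _ | n
  · rw [coeff_zero_X_mul] at key
    linear_combination (norm := (push_cast; ring)) key
  · rw [coeff_succ_X_mul, coeff_derivative] at key
    linear_combination (norm := (push_cast; ring)) key

/-- Multisets of `n` pairs in `Fin m × Fin m`, invariant under swapping the coordinates, and all
of whose pairs have coordinates of the same parity. -/
def symmMultisets (m n : ℕ) : Set (Multiset (Fin m × Fin m)) :=
  {S | S.card = n ∧ S.map Prod.swap = S ∧ ∀ p ∈ S, p.1.val % 2 = p.2.val % 2}

/-- The pairs `a < b` in `Fin m` of the same parity. -/
abbrev ParityPairs (m : ℕ) : Type := {p : Fin m × Fin m // p.1 < p.2 ∧ p.1.val % 2 = p.2.val % 2}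

/-- The symmetric multiset with given diagonal part and given part above the diagonal. -/
def symmMultiset {m : ℕ} (x : Multiset (Fin m)) (y : Multiset (ParityPairs m)) :
    Multiset (Fin m × Fin m) :=
  x.map (fun a => (a, a)) + (y.map (fun p => p.1) + y.map (fun p => p.1.swap))

lemma filter_eq_symmMultiset {m : ℕ} (x : Multiset (Fin m)) (y : Multiset (ParityPairs m)) :
    (symmMultiset x y).filter (fun p => p.1 = p.2) = x.map (fun a => (a, a)) := by
  rw [symmMultiset, Multiset.filter_add, Multiset.filter_add, Multiset.filter_eq_self.2,
    Multiset.filter_eq_nil.2, Multiset.filter_eq_nil.2, add_zero, add_zero]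
  · simp only [Multiset.mem_map]
    rintro _ ⟨p, -, rfl⟩ h
    exact p.2.1.ne h.symm
  · simp only [Multiset.mem_map]
    rintro _ ⟨p, -, rfl⟩ h
    exact p.2.1.ne h
  · simp only [Multiset.mem_map]
    rintro _ ⟨p, -, rfl⟩
    rfl

lemma filter_lt_symmMultiset {m : ℕ} (x : Multiset (Fin m)) (y : Multiset (ParityPairs m)) :
    (symmMultiset x y).filter (fun p => p.1 < p.2) = y.map (fun p => p.1) := by
  rw [symmMultiset, Multiset.filter_add, Multiset.filter_add, Multiset.filter_eq_nil.2,
    Multiset.filter_eq_self.2, Multiset.filter_eq_nil.2, add_zero, zero_add]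
  · simp only [Multiset.mem_map]
    rintro _ ⟨p, -, rfl⟩ h
    exact lt_asymm p.2.1 h
  · simp only [Multiset.mem_map]
    rintro _ ⟨p, -, rfl⟩
    exact p.2.1
  · simp only [Multiset.mem_map]
    rintro _ ⟨p, -, rfl⟩ h
    exact lt_irrefl _ h

lemma symmMultiset_mem {m : ℕ} (x : Multiset (Fin m)) (y : Multiset (ParityPairs m)) :
    symmMultiset x y ∈ symmMultisets m (x.card + 2 * y.card) := by
  refine ⟨by simp [symmMultiset]; ring, ?_, ?_⟩
  · simp only [symmMultiset, Multiset.map_add, Multiset.map_map, Function.comp_def, Prod.swap_swap]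
    rw [add_comm (y.map _)]
    rfl
  · simp only [symmMultiset, Multiset.mem_add, Multiset.mem_map]
    rintro _ (⟨a, -, rfl⟩ | ⟨p, -, rfl⟩ | ⟨p, -, rfl⟩)
    · rfl
    · exact p.2.2
    · exact p.2.2.symm

lemma exists_symmMultiset {m n : ℕ} {S : Multiset (Fin m × Fin m)} (hS : S ∈ symmMultisets m n) :
    ∃ x y, symmMultiset x y = S := by
  obtain ⟨-, hswap, hpar⟩ := hS
  obtain ⟨y, hy⟩ : ∃ y : Multiset (ParityPairs m),
      y.map (fun p => p.1) = S.filter (fun p => p.1 < p.2) := by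
    refine ⟨(S.filter (fun p => p.1 < p.2)).pmap Subtype.mk fun p hp => ?_, ?_⟩
    · rw [Multiset.mem_filter] at hp
      exact ⟨hp.2, hpar p hp.1⟩
    · rw [Multiset.map_pmap, Multiset.pmap_eq_map, Multiset.map_id']
  refine ⟨(S.filter (fun p => p.1 = p.2)).map Prod.fst, y, ?_⟩
  have h1 : y.map (fun p => p.1.swap) = S.filter (fun p => p.2 < p.1) := by
    conv_rhs => rw [← hswap, Multiset.filter_map]
    rw [show (fun p : ParityPairs m => p.1.swap) = Prod.swap ∘ fun p => p.1 from rfl,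
      ← Multiset.map_map, hy]
    rfl
  have h2 : ((S.filter (fun p => p.1 = p.2)).map Prod.fst).map (fun a => (a, a)) =
      S.filter (fun p => p.1 = p.2) := by
    rw [Multiset.map_map]
    conv_rhs => rw [← Multiset.map_id' (S.filter (fun p => p.1 = p.2))]
    refine Multiset.map_congr rfl fun p hp => ?_
    exact Prod.ext rfl (Multiset.mem_filter.1 hp).2
  rw [symmMultiset, h1, h2, hy]
  ext p
  simp only [Multiset.count_add, Multiset.count_filter]
  rcases lt_trichotomy p.1 p.2 with h | h | h
  · simp [h, h.ne, h.not_gt]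
  · simp [h]
  · simp [h, h.ne', h.not_gt]

/-- Symmetric multisets of size `n`, split according to the sizes of their diagonal and
off-diagonal parts. -/
noncomputable def symmMultisetsEquiv (m n : ℕ) :
    (Σ p : Finset.HasAntidiagonal.antidiagonal n, Sym (Fin m) p.1.1 ×
      {y : Multiset (ParityPairs m) // 2 * y.card = p.1.2}) ≃ symmMultisets m n :=
  Equiv.ofBijective
    (fun z => ⟨symmMultiset z.2.1.1 z.2.2.1, by
      have := symmMultiset_mem z.2.1.1 z.2.2.1
      rwa [z.2.1.2, z.2.2.2, Finset.HasAntidiagonal.mem_antidiagonal.1 z.1.2] at this⟩) <| by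
    constructor
    · rintro ⟨⟨⟨p, q⟩, hp⟩, ⟨x, hx⟩, ⟨y, hy⟩⟩ ⟨⟨⟨p', q'⟩, hp'⟩, ⟨x', hx'⟩, ⟨y', hy'⟩⟩ h
      have h : symmMultiset x y = symmMultiset x' y' := congrArg Subtype.val h
      have e1 := congrArg (Multiset.filter (fun p => p.1 = p.2)) h
      have e2 := congrArg (Multiset.filter (fun p => p.1 < p.2)) h
      rw [filter_eq_symmMultiset, filter_eq_symmMultiset] at e1
      rw [filter_lt_symmMultiset, filter_lt_symmMultiset] at e2
      obtain rfl := Multiset.map_injective (fun a b h => (Prod.ext_iff.1 h).1) e1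
      obtain rfl := Multiset.map_injective Subtype.val_injective e2
      dsimp only at hx hx' hy hy'
      subst hx hx' hy hy'
      rfl
    · rintro ⟨S, hS⟩
      obtain ⟨x, y, rfl⟩ := exists_symmMultiset hS
      have hn := (symmMultiset_mem x y).1.symm.trans hS.1
      exact ⟨⟨⟨(x.card, 2 * y.card), Finset.HasAntidiagonal.mem_antidiagonal.2 hn⟩, ⟨x, rfl⟩,
        ⟨y, rfl⟩⟩, rfl⟩

lemma card_multiset_two_mul_card_eq (α : Type*) [Fintype α] (r : ℕ) :
    Nat.card {y : Multiset α // 2 * y.card = r} =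
      if Even r then (Fintype.card α).multichoose (r / 2) else 0 := by
  split_ifs with h
  · obtain ⟨t, rfl⟩ := h
    rw [← Sym.card_sym_eq_multichoose, ← Nat.card_eq_fintype_card]
    refine Nat.card_congr (Equiv.subtypeEquivRight fun y => ?_)
    omega
  · have : IsEmpty {y : Multiset α // 2 * y.card = r} :=
      ⟨fun y => h (by rw [← y.2]; exact even_two_mul _)⟩
    exact Nat.card_of_isEmpty

lemma finite_multiset_two_mul_card_eq (α : Type*) [Fintype α] (r : ℕ) :
    Finite {y : Multiset α // 2 * y.card = r} :=
  Finite.of_injective (β := Sym α (r / 2)) (fun y => ⟨y.1, by have := y.2; omega⟩)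
    fun a b h => Subtype.ext (Subtype.mk.inj h)

lemma card_symmMultisets (m n : ℕ) :
    Nat.card (symmMultisets m n) = ∑ p ∈ Finset.HasAntidiagonal.antidiagonal n, m.multichoose p.1 *
      (if Even p.2 then (Fintype.card (ParityPairs m)).multichoose (p.2 / 2) else 0) := by
  have := finite_multiset_two_mul_card_eq (ParityPairs m)
  rw [← Nat.card_congr (symmMultisetsEquiv m n), Nat.card_sigma,
    ← Finset.sum_coe_sort (Finset.HasAntidiagonal.antidiagonal n)]
  refine Finset.sum_congr rfl fun p _ => ?_
  rw [Nat.card_prod, card_multiset_two_mul_card_eq, Nat.card_eq_fintype_card,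
    Sym.card_sym_eq_multichoose, Fintype.card_fin]

lemma card_parityPairs (j : ℕ) : Fintype.card (ParityPairs (2 * j + 1)) = j ^ 2 := by
  have h (b : ℕ) : ∀ m, b < m → ((Finset.univ : Finset (Fin m)).filter fun a =>
      a.val < b ∧ a.val % 2 = b % 2).card = b / 2 := by
    intro m hb
    rw [← Finset.card_range (b / 2)]
    refine (Finset.card_bij (fun t ht => ⟨2 * t + b % 2, by rw [Finset.mem_range] at ht; omega⟩)
      ?_ ?_ ?_).symm
    · intro t ht
      rw [Finset.mem_range] at ht
      simp only [Finset.mem_filter, Finset.mem_univ, true_and]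
      omega
    · intro s _ t _ hst
      simp only [Fin.mk.injEq] at hst
      omega
    · intro a ha
      simp only [Finset.mem_filter, Finset.mem_univ, true_and] at ha
      exact ⟨a.val / 2, by rw [Finset.mem_range]; omega, Fin.ext (by simp only; omega)⟩
  have hsum : ∑ b ∈ Finset.range (2 * j + 1), b / 2 = j ^ 2 := by
    induction j with
    | zero => rfl
    | succ j ih =>
      rw [show 2 * (j + 1) + 1 = 2 * j + 1 + 1 + 1 by ring, Finset.sum_range_succ,
        Finset.sum_range_succ, ih, show (2 * j + 1) / 2 = j by omega,
        show (2 * j + 1 + 1) / 2 = j + 1 by omega]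
      ring
  rw [Fintype.card_subtype, Finset.card_filter, Fintype.sum_prod_type_right, ← hsum,
    Finset.sum_range]
  refine Finset.sum_congr rfl fun b _ => ?_
  rw [← Finset.card_filter]
  exact h b _ b.2

lemma card_symmMultisets_recurrence (j n : ℕ) :
    ((n : ℤ) + 2) * Nat.card (symmMultisets (2 * j + 1) (n + 2)) =
      (2 * j + 1) * Nat.card (symmMultisets (2 * j + 1) (n + 1)) +
      (2 * j ^ 2 + 2 * j + 1 + n) * Nat.card (symmMultisets (2 * j + 1) n) := by
  have := sum_antidiagonal_recurrence (A := fun p => ((2 * j + 1).multichoose p : ℤ))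
    (B := fun r => if Even r then ((j ^ 2).multichoose (r / 2) : ℤ) else 0)
    (d := 2 * j + 1) (e := j ^ 2) ?_ (by simp) ?_ n
  · simp only [card_symmMultisets, card_parityPairs]
    push_cast
    convert this using 2
    ring
  · intro n
    have := succ_mul_multichoose_succ (2 * j + 1) n
    exact_mod_cast this
  · intro n
    rcases Nat.even_or_odd n with h | h
    · rw [if_pos h, if_pos (by simpa [Nat.even_add] using h)]
      obtain ⟨t, rfl⟩ := h
      have := succ_mul_multichoose_succ (j ^ 2) t
      rw [show (t + t + 2) / 2 = t + 1 by omega, show (t + t) / 2 = t by omega]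
      zify at this
      push_cast
      linarith
    · rw [if_neg (Nat.not_even_iff_odd.2 h), if_neg]
      · simp
      · rw [Nat.not_even_iff_odd]
        exact h.add_even even_two

lemma card_symmMultisets_zero (m : ℕ) : Nat.card (symmMultisets m 0) = 1 := by
  rw [card_symmMultisets]
  simp

lemma card_symmMultisets_one (m : ℕ) : Nat.card (symmMultisets m 1) = m := by
  rw [card_symmMultisets]
  simp [Finset.Nat.antidiagonal_succ]

/-! ### Standard labelings of involutions -/

lemma eq_of_monotone_of_map_eq {α : Type*} [LinearOrder α] {n : ℕ} {f g : Fin n → α}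
    (hf : Monotone f) (hg : Monotone g)
    (h : Finset.univ.val.map f = Finset.univ.val.map g) : f = g := by
  rw [Fin.univ_val_map, Fin.univ_val_map, Multiset.coe_eq_coe] at h
  exact List.ofFn_injective
    (h.eq_of_pairwise' hf.sortedLE_ofFn.pairwise hg.sortedLE_ofFn.pairwise)

lemma exists_monotone_map_eq {α : Type*} [LinearOrder α] {n : ℕ} {S : Multiset α}
    (hS : S.card = n) : ∃ f : Fin n → α, Monotone f ∧ Finset.univ.val.map f = S := by
  induction S using Quotient.inductionOn with
  | _ L =>
    obtain rfl : L.length = n := hS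
    refine ⟨L.get ∘ Tuple.sort L.get, Tuple.monotone_sort _, ?_⟩
    rw [← Multiset.map_map, Multiset.map_univ_val_equiv, Fin.univ_val_map, List.ofFn_get]
    rfl

lemma card_monotone_fin (n m : ℕ) :
    Nat.card {f : Fin n → Fin m // Monotone f} = m.multichoose n := by
  rw [← Sym.card_sym_fin_eq_multichoose, ← Nat.card_eq_fintype_card]
  refine Nat.card_eq_of_bijective
    (fun f => (⟨Finset.univ.val.map f.1, by simp⟩ : Sym (Fin m) n)) ⟨fun f g h => ?_, fun S => ?_⟩
  · exact Subtype.ext (eq_of_monotone_of_map_eq f.2 g.2 (Subtype.mk.inj h))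
  · obtain ⟨f, hf, hS⟩ := exists_monotone_map_eq S.2
    exact ⟨⟨f, hf⟩, Subtype.ext hS⟩

/-- A labeling `l` of the points moved by an involution `u`: it respects parity along `u`, and it
is weakly increasing with `u` increasing on every set of points with equal labels. -/
structure IsStdLabeling {n m : ℕ} (u : Equiv.Perm (Fin n)) (l : Fin n → Fin m) : Prop where
  invol : ∀ i, u (u i) = i
  parity : ∀ i, (l (u i)).val % 2 = (l i).val % 2
  lt_or_eq : ∀ i j, i < j → l i < l j ∨ l i = l j ∧ u i < u j

namespace IsStdLabeling

variable {n m : ℕ} {u : Equiv.Perm (Fin n)} {l : Fin n → Fin m}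

lemma monotone (h : IsStdLabeling u l) : Monotone l :=
  monotone_iff_forall_lt.2 fun i j hij => (h.lt_or_eq i j hij).elim le_of_lt fun e => e.1.le

lemma monotone_toLex (h : IsStdLabeling u l) : Monotone fun i => toLex (l i, l (u i)) :=
  monotone_iff_forall_lt.2 fun i j hij => Prod.Lex.toLex_le_toLex.2 <|
    (h.lt_or_eq i j hij).imp id fun e => ⟨e.1, h.monotone e.2.le⟩

lemma eq_sort (h : IsStdLabeling u l) : u = Tuple.sort (l ∘ u) := by
  rw [Tuple.eq_sort_iff]
  simp only [Function.comp_def, h.invol]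
  exact ⟨h.monotone, fun i j hij e => ((h.lt_or_eq i j hij).resolve_left e.not_lt).2⟩

lemma map_mem (h : IsStdLabeling u l) :
    Finset.univ.val.map (fun i => (l i, l (u i))) ∈ symmMultisets m n := by
  refine ⟨by simp, ?_, ?_⟩
  · rw [Multiset.map_map]
    conv_rhs => rw [← Multiset.map_univ_val_equiv u, Multiset.map_map]
    simp [h.invol]
  · intro p hp
    obtain ⟨i, -, rfl⟩ := Multiset.mem_map.1 hp
    exact (h.parity i).symm

end IsStdLabeling

lemma exists_isStdLabeling {n m : ℕ} {S : Multiset (Fin m × Fin m)} (hS : S ∈ symmMultisets m n) :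
    ∃ (u : Equiv.Perm (Fin n)) (l : Fin n → Fin m), IsStdLabeling u l ∧
      Finset.univ.val.map (fun i => (l i, l (u i))) = S := by
  obtain ⟨hcard, hswap, hpar⟩ := hS
  obtain ⟨f, hf, hfS⟩ := exists_monotone_map_eq (α := Fin m ×ₗ Fin m) (S := S.map toLex) (n := n)
    (by simpa using hcard)
  let a : Fin n → Fin m := fun i => (ofLex (f i)).1
  let b : Fin n → Fin m := fun i => (ofLex (f i)).2
  have hS : Finset.univ.val.map (fun i => (a i, b i)) = S := by
    have := congrArg (Multiset.map ofLex) hfS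
    rw [Multiset.map_map, Multiset.map_map] at this
    exact this.trans (Multiset.map_id' S)
  have hab (i j : Fin n) (hij : i < j) : a i < a j ∨ a i = a j ∧ b i ≤ b j :=
    Prod.Lex.le_iff.1 (hf hij.le)
  have ha : Monotone a := monotone_iff_forall_lt.2 fun i j hij =>
    (hab i j hij).elim le_of_lt fun e => e.1.le
  have hSab : Finset.univ.val.map (fun i => (b i, a i)) = S := by
    conv_rhs => rw [← hswap, ← hS, Multiset.map_map]
    rfl
  let u := Tuple.sort b
  obtain ⟨hbu, hties⟩ := Tuple.eq_sort_iff.1 (rfl : u = Tuple.sort b)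
  have hba : b ∘ u = a := by
    refine eq_of_monotone_of_map_eq hbu ha ?_
    rw [← Multiset.map_map, Multiset.map_univ_val_equiv]
    have := congrArg (Multiset.map Prod.fst) (hSab.trans hS.symm)
    rwa [Multiset.map_map, Multiset.map_map] at this
  have hau : a ∘ u = b := by
    have : (fun i => toLex (a i, a (u i))) = fun i => toLex (a i, b i) := by
      refine eq_of_monotone_of_map_eq ?_ hf ?_
      · refine monotone_iff_forall_lt.2 fun i j hij => Prod.Lex.toLex_le_toLex.2 ?_
        refine (ha hij.le).lt_or_eq.imp id fun e => ⟨e, ha (hties i j hij ?_).le⟩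
        rw [← hba] at e
        exact e
      · have e1 : Finset.univ.val.map (fun i => (b (u i), a (u i))) = S := by
          rw [← hSab]
          conv_rhs => rw [← Multiset.map_univ_val_equiv u, Multiset.map_map]
          rfl
        have e2 := congrArg (Multiset.map toLex) (e1.trans hS.symm)
        rw [Multiset.map_map, Multiset.map_map, ← hba] at e2
        rw [← hba]
        exact e2
    funext i
    exact congrArg (fun f => (ofLex (f i)).2) this
  have hinv : u⁻¹ = u := by
    refine Tuple.eq_sort_iff.2 ⟨?_, fun i j hij e => ?_⟩
    · rw [← hau, Function.comp_assoc, ← Equiv.Perm.coe_mul, mul_inv_cancel]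
      exact ha
    · by_contra! hle
      have hlt : u⁻¹ j < u⁻¹ i := lt_of_le_of_ne hle fun h => hij.ne' (u⁻¹.injective h)
      have ea : a i = a j := by
        rw [← hau] at e
        simpa using e
      have eb (t : Fin n) : a (u⁻¹ t) = b t := by rw [← hba]; simp
      rcases hab _ _ hlt with h | ⟨h, -⟩
      · rw [eb, eb] at h
        rcases hab i j hij with h' | ⟨-, h'⟩
        · exact h'.ne ea
        · exact h'.not_gt h
      · have := hties _ _ hlt (by simpa [← hba] using h)
        rw [show u (u⁻¹ j) = j from u.apply_symm_apply j,
          show u (u⁻¹ i) = i from u.apply_symm_apply i] at this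
        exact lt_asymm hij this
  have hinvol (i : Fin n) : u (u i) = i := by
    rw [← congrArg (fun v : Equiv.Perm (Fin n) => v (u i)) hinv]
    exact u.symm_apply_apply i
  have hb (i : Fin n) : a (u i) = b i := congrFun hau i
  refine ⟨u, a, ⟨hinvol, fun i => ?_, fun i j hij => ?_⟩, ?_⟩
  · rw [hb]
    exact (hpar (a i, b i) (hS ▸ Multiset.mem_map.2 ⟨i, Finset.mem_univ_val _, rfl⟩)).symm
  · refine (ha hij.le).lt_or_eq.imp id fun e => ⟨e, hties i j hij ?_⟩
    rw [← hba] at e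
    exact e
  · simp only [hb]
    exact hS

lemma card_isStdLabeling (n m : ℕ) :
    Nat.card {p : Equiv.Perm (Fin n) × (Fin n → Fin m) // IsStdLabeling p.1 p.2} =
      Nat.card (symmMultisets m n) := by
  refine Nat.card_eq_of_bijective (fun p => ⟨_, p.2.map_mem⟩) ⟨?_, ?_⟩
  · rintro ⟨⟨u, l⟩, h⟩ ⟨⟨u', l'⟩, h'⟩ e
    have e := congrArg (Multiset.map toLex) (Subtype.mk.inj e)
    rw [Multiset.map_map, Multiset.map_map] at e
    have e := eq_of_monotone_of_map_eq h.monotone_toLex h'.monotone_toLex e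
    have e1 : l = l' := funext fun i => congrArg (fun f => (ofLex (f i)).1) e
    have e2 : l ∘ u = l' ∘ u' := funext fun i => congrArg (fun f => (ofLex (f i)).2) e
    refine Subtype.ext (Prod.ext ?_ e1)
    rw [h.eq_sort, h'.eq_sort, e2]
  · rintro ⟨S, hS⟩
    obtain ⟨u, l, h, rfl⟩ := exists_isStdLabeling hS
    exact ⟨⟨(u, l), h⟩, rfl⟩

/-! ### Counting labelings with prescribed parities -/

lemma forall_lt_lex_iff {n m : ℕ} {u : Fin (n + 1) → Fin (n + 1)} {l : Fin (n + 1) → Fin m} :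
    (∀ i j, i < j → l i < l j ∨ l i = l j ∧ u i < u j) ↔
      ∀ i : Fin n, l i.castSucc < l i.succ ∨
        l i.castSucc = l i.succ ∧ u i.castSucc < u i.succ := by
  have := Fin.strictMono_iff_lt_succ (f := fun i => toLex (l i, u i))
  simp only [Prod.Lex.toLex_lt_toLex] at this
  rw [← this]
  simp only [StrictMono, Prod.Lex.toLex_lt_toLex]

/-- Labelings by `0, …, 2 * j` with parities `σ`, increasing at the ascents of `u`, correspond to
weakly increasing maps, by subtracting from each label twice the number `d` of preceding forced
increments. -/
lemma card_labelings_of_steps {n : ℕ} {u : Fin (n + 1) → Fin (n + 1)}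
    (hu : Function.Injective u) {σ d : Fin (n + 1) → ℕ} (hσ : ∀ i, σ i ≤ 1) (hd0 : d 0 = σ 0)
    (hd : ∀ i : Fin n, d i.succ = d i.castSucc +
      if σ i.castSucc < σ i.succ ∨ σ i.castSucc = σ i.succ ∧ u i.succ < u i.castSucc
      then 1 else 0) (j : ℕ) :
    Nat.card {l : Fin (n + 1) → Fin (2 * j + 1) // (∀ i, (l i).val % 2 = σ i) ∧
      ∀ i j, i < j → l i < l j ∨ l i = l j ∧ u i < u j} =
      (j + 1 - d (Fin.last n)).multichoose (n + 1) := by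
  have hne (i : Fin n) : u i.castSucc ≠ u i.succ := fun h =>
    Fin.castSucc_lt_succ.ne (hu h)
  have hσd (i : Fin (n + 1)) : σ i ≤ d i := by
    induction i using Fin.induction with
    | zero => exact hd0.ge
    | succ i ih =>
      have := hd i
      have := hσ i.succ
      split_ifs at * <;> omega
  have hdmono : Monotone d := Fin.monotone_iff_le_succ.2 fun i => by rw [hd]; omega
  simp only [forall_lt_lex_iff]
  rw [← card_monotone_fin]
  symm
  refine Nat.card_eq_of_bijective (fun g => ⟨fun i =>
    ⟨2 * ((g.1 i).val + d i) - σ i, ?_⟩, ?_, ?_⟩) ⟨?_, ?_⟩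
  · have := (g.1 i).2
    have := hdmono (Fin.le_last i)
    omega
  · intro i
    have := hσ i
    have := hσd i
    dsimp only
    omega
  · intro i
    have h1 := hd i
    have h2 : (g.1 i.castSucc).val ≤ (g.1 i.succ).val := g.2 Fin.castSucc_lt_succ.le
    have h3 := hσ i.castSucc
    have h4 := hσ i.succ
    have h5 := hσd i.castSucc
    have h6 := hσd i.succ
    have h7 := hne i
    simp only [Fin.lt_def, Fin.ext_iff, ne_eq] at *
    split_ifs at h1 <;> omega
  · intro g g' h
    refine Subtype.ext (funext fun i => Fin.ext ?_)
    have h1 := congrArg (fun l => (l i).val) (Subtype.mk.inj h)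
    have h2 := hσd i
    dsimp only at h1
    omega
  · rintro ⟨l, hpar, hl⟩
    have hstep (i : Fin n) : ((l i.castSucc).val + σ i.castSucc) / 2 + d i.succ ≤
        ((l i.succ).val + σ i.succ) / 2 + d i.castSucc := by
      have h1 := hd i
      have h2 := hl i
      have h3 := hpar i.castSucc
      have h4 := hpar i.succ
      simp only [Fin.lt_def, Fin.ext_iff] at *
      split_ifs at h1 <;> omega
    have hdl (i : Fin (n + 1)) : d i ≤ ((l i).val + σ i) / 2 := by
      induction i using Fin.induction with
      | zero => rw [hd0]; have := hpar 0; omega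
      | succ i ih => have := hstep i; omega
    have hmono : Monotone fun i => ((l i).val + σ i) / 2 - d i :=
      Fin.monotone_iff_le_succ.2 fun i => by
        have := hstep i
        have := hdl i.castSucc
        omega
    refine ⟨⟨fun i => ⟨((l i).val + σ i) / 2 - d i, ?_⟩, fun a b hab => hmono hab⟩, ?_⟩
    · have h1 := hmono (Fin.le_last i)
      have h2 := hdl (Fin.last n)
      have h3 := hpar (Fin.last n)
      have h4 := (l (Fin.last n)).2
      dsimp only at h1
      omega
    · refine Subtype.ext (funext fun i => Fin.ext ?_)
      have h1 := hdl i
      have h2 := hpar i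
      dsimp only
      omega

/-! ### Signed involutions -/

lemma mem_OmegaSet_iff {n : ℕ} {a : ℤ} : a ∈ OmegaSet n ↔ 1 ≤ a.natAbs ∧ a.natAbs ≤ n := by
  change 1 ≤ |a| ∧ |a| ≤ (n : ℤ) ↔ _
  rw [Int.abs_eq_natAbs]
  omega

/-- The signed permutation with underlying permutation `u` and sign pattern `s`. -/
def signedMap {n : ℕ} (u : Equiv.Perm (Fin n)) (s : Fin n → Bool) (a : ℤ) : ℤ :=
  a.sign * if h : a.natAbs - 1 < n then
    (if s ⟨a.natAbs - 1, h⟩ then -((u ⟨a.natAbs - 1, h⟩ : ℤ) + 1)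
      else (u ⟨a.natAbs - 1, h⟩ : ℤ) + 1)
    else a.natAbs

section signedMap

variable {n : ℕ} (u : Equiv.Perm (Fin n)) (s : Fin n → Bool)

lemma signedMap_neg (a : ℤ) : signedMap u s (-a) = -signedMap u s a := by
  simp only [signedMap, Int.sign_neg, Int.natAbs_neg, neg_mul]

lemma signedMap_zero : signedMap u s 0 = 0 := by simp [signedMap]

lemma signedMap_add_one (i : Fin n) :
    signedMap u s ((i : ℤ) + 1) = if s i then -((u i : ℤ) + 1) else (u i : ℤ) + 1 := by
  have h1 : ((i : ℤ) + 1).natAbs - 1 = i := by omega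
  have h2 : ((i : ℤ) + 1).sign = 1 := Int.sign_eq_one_of_pos (by omega)
  simp only [signedMap, h1, h2, one_mul, Fin.is_lt, dite_true, Fin.eta]

lemma signedMap_of_notMem {a : ℤ} (ha : a ∉ OmegaSet n) : signedMap u s a = a := by
  rcases eq_or_ne a 0 with rfl | h0
  · exact signedMap_zero u s
  · have : ¬ a.natAbs - 1 < n := fun h => ha (mem_OmegaSet_iff.2 (by omega))
    rw [signedMap, dif_neg this]
    exact Int.sign_mul_natAbs a

lemma signedMap_injective :
    Function.Injective fun p : Equiv.Perm (Fin n) × (Fin n → Bool) => signedMap p.1 p.2 := by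
  rintro ⟨u, s⟩ ⟨u', s'⟩ h
  have h (i : Fin n) : (u i).val = (u' i).val ∧ s i = s' i := by
    have := congrFun h ((i : ℤ) + 1)
    simp only [signedMap_add_one] at this
    cases hs : s i <;> cases hs' : s' i <;> simp [hs, hs'] at this ⊢ <;> omega
  exact Prod.ext (Equiv.ext fun i => Fin.ext (h i).1) (funext fun i => (h i).2)

end signedMap

lemma exists_fin_of_mem_OmegaSet {n : ℕ} {a : ℤ} (ha : a ∈ OmegaSet n) :
    ∃ i : Fin n, a = (i : ℤ) + 1 ∨ a = -((i : ℤ) + 1) := by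
  obtain ⟨h1, h2⟩ := mem_OmegaSet_iff.1 ha
  exact ⟨⟨a.natAbs - 1, by omega⟩, by dsimp only; omega⟩

lemma add_one_mem_OmegaSet {n : ℕ} (i : Fin n) : (i : ℤ) + 1 ∈ OmegaSet n := by
  exact mem_OmegaSet_iff.2 (by omega)

lemma neg_mem_OmegaSet {n : ℕ} {a : ℤ} (ha : a ∈ OmegaSet n) : -a ∈ OmegaSet n := by
  simpa only [mem_OmegaSet_iff, Int.natAbs_neg] using ha

lemma eq_of_forall_fin {n : ℕ} {v w : ℤ → ℤ} (hv : ∀ a, v (-a) = -v a) (hw : ∀ a, w (-a) = -w a)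
    (hout : ∀ a, a ∉ OmegaSet n → v a = w a) (h : ∀ i : Fin n, v ((i : ℤ) + 1) = w ((i : ℤ) + 1)) :
    v = w := by
  funext a
  by_cases ha : a ∈ OmegaSet n
  · obtain ⟨i, rfl | rfl⟩ := exists_fin_of_mem_OmegaSet ha
    · exact h i
    · rw [hv, hw, h]
  · exact hout a ha

/-- The underlying permutations and sign patterns of the signed involutions. -/
noncomputable def signedInvolutions (n : ℕ) : Finset (Equiv.Perm (Fin n) × (Fin n → Bool)) :=
  Finset.univ.filter fun p => ∀ i, p.1 (p.1 i) = i ∧ p.2 (p.1 i) = p.2 i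

lemma isSignedInvolution_signedMap {n : ℕ} {p : Equiv.Perm (Fin n) × (Fin n → Bool)}
    (hp : p ∈ signedInvolutions n) : IsSignedInvolution n (signedMap p.1 p.2) := by
  have hp := (Finset.mem_filter.1 hp).2
  have hneg := signedMap_neg p.1 p.2
  have hinv : signedMap p.1 p.2 ∘ signedMap p.1 p.2 = id := by
    refine eq_of_forall_fin (n := n) (fun a => ?_) (fun a => rfl) (fun a ha => ?_) fun i => ?_
    · simp only [Function.comp_apply, hneg]
    · simp only [Function.comp_apply, signedMap_of_notMem _ _ ha, id]
    · simp only [Function.comp_apply, signedMap_add_one, id]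
      split_ifs with h
      · rw [hneg, signedMap_add_one, (hp i).1, (hp i).2, if_pos h, neg_neg]
      · rw [signedMap_add_one, (hp i).1, (hp i).2, if_neg h]
  have hmaps : Set.MapsTo (signedMap p.1 p.2) (OmegaSet n) (OmegaSet n) := by
    have h (i : Fin n) : signedMap p.1 p.2 ((i : ℤ) + 1) ∈ OmegaSet n := by
      rw [signedMap_add_one]
      split_ifs
      · exact neg_mem_OmegaSet (add_one_mem_OmegaSet _)
      · exact add_one_mem_OmegaSet _
    intro a ha
    obtain ⟨i, rfl | rfl⟩ := exists_fin_of_mem_OmegaSet ha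
    · exact h i
    · rw [hneg]
      exact neg_mem_OmegaSet (h i)
  have hinv (a : ℤ) : signedMap p.1 p.2 (signedMap p.1 p.2 a) = a := congrFun hinv a
  refine ⟨⟨hneg, ⟨hmaps, ?_, ?_⟩, fun a ha => signedMap_of_notMem _ _ ha⟩, hinv⟩
  · exact (Function.LeftInverse.injective hinv).injOn
  · exact fun a ha => ⟨_, hmaps ha, hinv a⟩

lemma exists_signedMap_eq {n : ℕ} {w : ℤ → ℤ} (hw : IsSignedInvolution n w) :
    ∃ p ∈ signedInvolutions n, signedMap p.1 p.2 = w := by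
  obtain ⟨⟨hneg, hbij, hout⟩, hinv⟩ := hw
  choose v hv using fun i : Fin n =>
    exists_fin_of_mem_OmegaSet (hbij.mapsTo (add_one_mem_OmegaSet i))
  have hvv (i : Fin n) : v (v i) = i ∧ (w ((v i : ℤ) + 1) < 0 ↔ w ((i : ℤ) + 1) < 0) := by
    have h1 := hinv ((i : ℤ) + 1)
    rcases hv i with h | h
    · rw [h] at h1
      rcases hv (v i) with h' | h' <;> rw [h1] at h' <;> rw [h1, h] <;>
        refine ⟨Fin.ext ?_, ?_⟩ <;> omega
    · rw [h, hneg] at h1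
      rcases hv (v i) with h' | h' <;> rw [h] <;> refine ⟨Fin.ext ?_, ?_⟩ <;> omega
  refine ⟨(⟨v, v, fun i => (hvv i).1, fun i => (hvv i).1⟩,
    fun i => decide (w ((i : ℤ) + 1) < 0)), ?_, ?_⟩
  · refine Finset.mem_filter.2 ⟨Finset.mem_univ _, fun i => ⟨(hvv i).1, ?_⟩⟩
    exact decide_eq_decide.2 (hvv i).2
  · refine eq_of_forall_fin (n := n) (signedMap_neg _ _) hneg (fun a ha => ?_) fun i => ?_
    · rw [signedMap_of_notMem _ _ ha, hout a ha]
    · rw [signedMap_add_one]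
      simp only [decide_eq_true_eq, Equiv.coe_fn_mk]
      rcases hv i with h | h <;> rw [h] <;> split_ifs <;> omega

lemma InkB_eq_card_s12 (n k : ℕ) :
    InkB n k = ((signedInvolutions n).filter fun p => desB n (signedMap p.1 p.2) = k).card := by
  rw [InkB, ← Set.ncard_coe_finset, ← Set.ncard_image_of_injective _ signedMap_injective]
  congr 1
  ext w
  simp only [Set.mem_ofPred_eq, Set.mem_image, Finset.coe_filter]
  constructor
  · rintro ⟨hw, hk⟩
    obtain ⟨p, hp, rfl⟩ := exists_signedMap_eq hw
    exact ⟨p, ⟨hp, hk⟩, rfl⟩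
  · rintro ⟨p, ⟨hp, hk⟩, rfl⟩
    exact ⟨isSignedInvolution_signedMap hp, hk⟩

lemma desB_succ (n : ℕ) (w : ℤ → ℤ) :
    desB (n + 1) w = desB n w + if rlt (w ((n : ℤ) + 1)) (w (n : ℤ)) then 1 else 0 := by
  rw [desB, desB, Finset.card_filter, Finset.card_filter, Finset.sum_range_succ]

lemma desB_le (n : ℕ) (w : ℤ → ℤ) : desB n w ≤ n :=
  (Finset.card_filter_le _ _).trans (Finset.card_range n).le

lemma card_labelings (n j : ℕ) (u : Equiv.Perm (Fin n)) (s : Fin n → Bool) :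
    Nat.card {l : Fin n → Fin (2 * j + 1) // (∀ i, (l i).val % 2 = (s i).toNat) ∧
      ∀ i j, i < j → l i < l j ∨ l i = l j ∧ u i < u j} =
      (j + 1 - desB n (signedMap u s)).multichoose n := by
  rcases n with _ | n
  · rw [Nat.multichoose_zero_right, Nat.card_eq_one_iff_unique]
    exact ⟨inferInstance, ⟨⟨finZeroElim, finZeroElim, finZeroElim⟩⟩⟩
  · refine card_labelings_of_steps u.injective (σ := fun i => (s i).toNat)
      (d := fun i => desB (i + 1) (signedMap u s)) (fun i => Bool.toNat_le _) ?_ (fun i => ?_) j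
    · have h := signedMap_add_one u s 0
      have h0 : desB 0 (signedMap u s) = 0 := rfl
      dsimp only [Fin.val_zero]
      rw [desB_succ, h0]
      simp only [Fin.val_zero] at h
      rw [h, Nat.cast_zero, signedMap_zero, rlt]
      cases s 0 <;> simp <;> omega
    · have h := signedMap_add_one u s i.castSucc
      have h' := signedMap_add_one u s i.succ
      dsimp only [Fin.val_succ, Fin.val_castSucc] at h h' ⊢
      rw [desB_succ (i + 1), h', Nat.cast_add_one, h]
      congr 1
      refine if_congr ?_ rfl rfl
      rw [rlt]
      cases s i.castSucc <;> cases s i.succ <;> simp <;> omega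

lemma card_isStdLabeling_eq_sum (n j : ℕ) :
    Nat.card {p : Equiv.Perm (Fin n) × (Fin n → Fin (2 * j + 1)) // IsStdLabeling p.1 p.2} =
      ∑ p ∈ signedInvolutions n, (j + 1 - desB n (signedMap p.1 p.2)).multichoose n := by
  rw [← Finset.sum_coe_sort]
  simp only [← card_labelings]
  rw [← Nat.card_sigma]
  symm
  refine Nat.card_eq_of_bijective (fun z => ⟨(z.1.1.1, z.2.1), ?_⟩) ⟨?_, ?_⟩
  · have h := (Finset.mem_filter.1 z.1.2).2
    exact ⟨fun i => (h i).1, fun i => by rw [z.2.2.1, z.2.2.1, (h i).2], z.2.2.2⟩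
  · rintro ⟨⟨⟨u, s⟩, hp⟩, ⟨l, hl⟩⟩ ⟨⟨⟨u', s'⟩, hp'⟩, ⟨l', hl'⟩⟩ h
    obtain ⟨rfl, rfl⟩ := Prod.mk.inj (Subtype.mk.inj h)
    obtain rfl : s = s' := funext fun i => by
      have := (hl.1 i).symm.trans (hl'.1 i)
      cases h : s i <;> cases h' : s' i <;> simp_all
    rfl
  · rintro ⟨⟨u, l⟩, h⟩
    refine ⟨⟨⟨(u, fun i => decide ((l i).val % 2 = 1)), ?_⟩, ⟨l, fun i => ?_, h.lt_or_eq⟩⟩, rfl⟩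
    · refine Finset.mem_filter.2 ⟨Finset.mem_univ _, fun i => ⟨h.invol i, ?_⟩⟩
      exact decide_eq_decide.2 (by rw [h.parity])
    · rcases Nat.mod_two_eq_zero_or_one (l i).val with e | e <;> simp [e]

lemma sum_InkB_mul_multichoose (n j : ℕ) :
    ∑ k ∈ Finset.range (n + 1), InkB n k * (j + 1 - k).multichoose n =
      Nat.card (symmMultisets (2 * j + 1) n) := by
  rw [← card_isStdLabeling, card_isStdLabeling_eq_sum]
  rw [← Finset.sum_fiberwise_of_maps_to (s := signedInvolutions n) (t := Finset.range (n + 1))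
    (g := fun p => desB n (signedMap p.1 p.2))
    (fun p _ => Finset.mem_range.2 (Nat.lt_succ_of_le (desB_le _ _)))]
  refine Finset.sum_congr rfl fun k _ => ?_
  rw [InkB_eq_card_s12, ← smul_eq_mul, ← Finset.sum_const]
  refine Finset.sum_congr rfl fun p hp => ?_
  rw [(Finset.mem_filter.1 hp).2]

/-! ### The recurrence for the numbers of signed involutions with given number of descents -/

/-- The number of symmetric multisets on `2 * j + 1` letters, extended by zero to negative `j`. -/
noncomputable def symmCount (n : ℕ) (j : ℤ) : ℤ :=
  if 0 ≤ j then (Nat.card (symmMultisets (2 * j.toNat + 1) n) : ℤ) else 0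

lemma symmCount_of_neg (n : ℕ) {j : ℤ} (hj : j < 0) : symmCount n j = 0 := if_neg hj.not_ge

lemma symmCount_natCast (n j : ℕ) :
    symmCount n j = Nat.card (symmMultisets (2 * j + 1) n) := if_pos (Int.natCast_nonneg j)

lemma IZ_of_neg (n : ℕ) {k : ℤ} (hk : k < 0) : IZ n k = 0 := if_neg hk.not_ge

lemma IZ_natCast (n k : ℕ) : IZ n k = InkB n k := if_pos (Int.natCast_nonneg k)

lemma IZ_nonneg (n : ℕ) (k : ℤ) : 0 ≤ IZ n k := by
  unfold IZ
  split_ifs <;> omega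

lemma InkB_of_lt {n k : ℕ} (hk : n < k) : InkB n k = 0 := by
  rw [InkB_eq_card_s12, Finset.card_eq_zero, Finset.filter_eq_empty_iff]
  exact fun p _ => ((desB_le n _).trans_lt hk).ne

lemma binomExt_sub {n j k : ℕ} (hk : k ≤ n) :
    binomExt n ((j : ℤ) - k) = ((j + 1 - k).multichoose n : ℕ) := by
  unfold binomExt
  split_ifs with h
  · rw [Nat.multichoose_eq]
    congr 2
    omega
  · have hn : n ≠ 0 := by omega
    rw [show j + 1 - k = 0 by omega, Nat.multichoose_eq, Nat.choose_eq_zero_of_lt (by omega),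
      Nat.cast_zero]

lemma symmCount_eq_sum (n : ℕ) (j : ℤ) :
    symmCount n j = ∑ k ∈ Finset.range (n + 1), (InkB n k : ℤ) * binomExt n (j - k) := by
  rcases lt_or_ge j 0 with hj | hj
  · rw [symmCount_of_neg n hj, Finset.sum_eq_zero]
    intro k _
    rw [binomExt, if_neg (by omega), mul_zero]
  · lift j to ℕ using hj
    rw [symmCount_natCast, ← sum_InkB_mul_multichoose]
    push_cast
    refine Finset.sum_congr rfl fun k hk => ?_
    rw [binomExt_sub (Nat.lt_succ_iff.1 (Finset.mem_range.1 hk))]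

lemma iterate_bdiff_symmCount (n : ℕ) (k : ℤ) : bdiff^[n + 1] (symmCount n) k = IZ n k := by
  rw [funext (symmCount_eq_sum n), iterate_bdiff_sum]
  simp only [iterate_bdiff_const_mul, iterate_bdiff_shift, iterate_bdiff_binomExt]
  rcases lt_or_ge k 0 with hk | hk
  · rw [IZ_of_neg n hk, Finset.sum_eq_zero]
    intro i _
    rw [if_neg (by omega), mul_zero]
  · lift k to ℕ using hk
    simp only [sub_eq_zero, Nat.cast_inj, mul_ite, mul_one, mul_zero, Finset.sum_ite_eq,
      Finset.mem_range, IZ_natCast]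
    split_ifs with h
    · rfl
    · rw [InkB_of_lt (by omega), Nat.cast_zero]

lemma symmCount_recurrence (n : ℕ) (j : ℤ) : ((n : ℤ) + 2) * symmCount (n + 2) j =
    (2 * j + 1) * symmCount (n + 1) j + (2 * j ^ 2 + 2 * j + 1 + n) * symmCount n j := by
  rcases lt_or_ge j 0 with hj | hj
  · simp only [symmCount_of_neg _ hj, mul_zero, add_zero]
  · lift j to ℕ using hj
    simp only [symmCount_natCast]
    exact card_symmMultisets_recurrence j n

lemma descentRecurrence_IZ : DescentRecurrence IZ :=
  descentRecurrence_of_samples iterate_bdiff_symmCount symmCount_recurrence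

lemma symmCount_zero (j : ℤ) : symmCount 0 j = if 0 ≤ j then 1 else 0 := by
  rw [symmCount, card_symmMultisets_zero, Nat.cast_one]

lemma symmCount_one (j : ℤ) : symmCount 1 j = if 0 ≤ j then 2 * j + 1 else 0 := by
  rw [symmCount, card_symmMultisets_one]
  split_ifs <;> omega

lemma IZ_symm (n : ℕ) (k : ℤ) : IZ n (n - k) = IZ n k := by
  refine descentRecurrence_IZ.symm (fun k => ?_) (fun k => ?_) n k
  · simp only [← iterate_bdiff_symmCount, zero_add, Function.iterate_one, bdiff, symmCount_zero]
    split_ifs <;> omega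
  · simp only [← iterate_bdiff_symmCount, iterate_bdiff_succ, Function.iterate_zero, id,
      symmCount_one]
    split_ifs <;> omega

lemma IZ_sub_one_le (n : ℕ) (k : ℤ) (hk : 2 * k ≤ n + 1) : IZ n (k - 1) ≤ IZ n k :=
  descentRecurrence_IZ.le_of_two_mul_le (fun n _ => IZ_of_neg n) IZ_nonneg IZ_symm n k hk

/-- Inequality (15) in the proof of Theorem 4.2: for every `n ≥ 3` and `0 ≤ k ≤ ⌊n/2⌋`,
`(2k+1)·I_{n-1,k}^B + (2n-4k+2)·I_{n-1,k-1}^B + (-2n+2k-3)·I_{n-1,k-2}^B ≥ 0`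
(with `I_{m,j}^B = 0` for `j < 0`). -/
theorem InkB_ineq_15 (n : ℕ) (hn : 3 ≤ n) (k : ℤ) (hk0 : 0 ≤ k) (hk : k ≤ ((n / 2 : ℕ) : ℤ)) :
    0 ≤ (2 * k + 1) * IZ (n - 1) k + (2 * (n : ℤ) - 4 * k + 2) * IZ (n - 1) (k - 1) +
        (-2 * (n : ℤ) + 2 * k - 3) * IZ (n - 1) (k - 2) := by
  have h1 := IZ_sub_one_le (n - 1) k (by omega)
  have h2 := IZ_sub_one_le (n - 1) (k - 1) (by omega)
  rw [sub_sub, show (1 : ℤ) + 1 = 2 from rfl] at h2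
  have h3 := mul_nonneg (show 0 ≤ 2 * k + 1 by omega) (sub_nonneg.2 h1)
  have h4 := mul_nonneg (show 0 ≤ 2 * (n : ℤ) + 3 - 2 * k by omega) (sub_nonneg.2 h2)
  linarith
end
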